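/- If a semigroup X is absolutely TzS-closed, then its ideal center IZ(X) is bounded (there is n ≥ 1 with zⁿ idempotent for all z ∈ IZ(X)) and is an absolutely T₂S-closed semigroup. -/

import Mathlib

universe u

open Set TopologicalSpace

/-- A topological space is zero-dimensional: it has a base of clopen sets. -/
def HasClopenBasis (Y : Type*) [TopologicalSpace Y] : Prop :=
  ∃ B : Set (Set Y), (∀ s ∈ B, IsClopen s) ∧ IsTopologicalBasis B

section TopClasses

variable (X : Type u) [Semigroup X]

/-- `X` is absolutely `T₁S`-closed: the image of every homomorphism to a `T₁`
topological semigroup is closed. -/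
def AbsolutelyT1SClosed : Prop :=
  ∀ (Y : Type u) [Semigroup Y] [TopologicalSpace Y] [ContinuousMul Y] [T1Space Y]
    (h : X →ₙ* Y), IsClosed (Set.range h)

/-- `X` is absolutely `T₂S`-closed. -/
def AbsolutelyT2SClosed : Prop :=
  ∀ (Y : Type u) [Semigroup Y] [TopologicalSpace Y] [ContinuousMul Y] [T2Space Y]
    (h : X →ₙ* Y), IsClosed (Set.range h)

/-- `X` is absolutely `TzS`-closed. -/
def AbsolutelyTzSClosed : Prop :=
  ∀ (Y : Type u) [Semigroup Y] [TopologicalSpace Y] [ContinuousMul Y] [T1Space Y],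
    HasClopenBasis Y → ∀ (h : X →ₙ* Y), IsClosed (Set.range h)

/-- `X` is `T₁S`-closed: the image of every injective homomorphism to a `T₁`
topological semigroup with discrete image is closed. -/
def T1SClosed : Prop :=
  ∀ (Y : Type u) [Semigroup Y] [TopologicalSpace Y] [ContinuousMul Y] [T1Space Y]
    (h : X →ₙ* Y), Function.Injective h → DiscreteTopology (Set.range h) →
      IsClosed (Set.range h)

/-- `X` is `T₂S`-closed. -/
def T2SClosed : Prop :=
  ∀ (Y : Type u) [Semigroup Y] [TopologicalSpace Y] [ContinuousMul Y] [T2Space Y]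
    (h : X →ₙ* Y), Function.Injective h → DiscreteTopology (Set.range h) →
      IsClosed (Set.range h)

/-- `X` is `TzS`-closed. -/
def TzSClosed : Prop :=
  ∀ (Y : Type u) [Semigroup Y] [TopologicalSpace Y] [ContinuousMul Y] [T1Space Y],
    HasClopenBasis Y → ∀ (h : X →ₙ* Y), Function.Injective h →
      DiscreteTopology (Set.range h) → IsClosed (Set.range h)

/-- `X` is injectively `T₂S`-closed. -/
def InjectivelyT2SClosed : Prop :=
  ∀ (Y : Type u) [Semigroup Y] [TopologicalSpace Y] [ContinuousMul Y] [T2Space Y]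
    (h : X →ₙ* Y), Function.Injective h → IsClosed (Set.range h)

/-- `X` is projectively `T₁S`-closed: all congruence quotients are `T₁S`-closed. -/
def ProjectivelyT1SClosed : Prop := ∀ c : Con X, T1SClosed c.Quotient

/-- `X` is projectively `TzS`-closed. -/
def ProjectivelyTzSClosed : Prop := ∀ c : Con X, TzSClosed c.Quotient

/-- `X` is projectively `T₁S`-discrete: every homomorphism into a `T₁`
topological semigroup has discrete image. -/
def ProjectivelyT1SDiscrete : Prop :=
  ∀ (Y : Type u) [Semigroup Y] [TopologicalSpace Y] [ContinuousMul Y] [T1Space Y]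
    (h : X →ₙ* Y), DiscreteTopology (Set.range h)

/-- `X` is projectively `TzS`-discrete. -/
def ProjectivelyTzSDiscrete : Prop :=
  ∀ (Y : Type u) [Semigroup Y] [TopologicalSpace Y] [ContinuousMul Y] [T1Space Y],
    HasClopenBasis Y → ∀ (h : X →ₙ* Y), DiscreteTopology (Set.range h)

end TopClasses

/-- `spow x n` is the power `x^(n+1)` in a semigroup; thus as `n` ranges over `ℕ`,
`spow x n` ranges over all powers `x^m`, `m ≥ 1`. -/
def spow {X : Type*} [Semigroup X] (x : X) : ℕ → X
  | 0 => x
  | n + 1 => spow x n * x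

section AlgDefs

variable (X : Type*) [Semigroup X]

/-- the set `E(X)` of idempotents. -/
def idemSet : Set X := {x | x * x = x}

/-- `H_e`, the maximal subgroup containing the idempotent `e`. -/
def maxSubgroup (e : X) : Set X :=
  {x | x * e = x ∧ e * x = x ∧ ∃ y, y * e = y ∧ e * y = y ∧ x * y = e ∧ y * x = e}

/-- The Clifford part `H(X) = ⋃_{e ∈ E(X)} H_e`. -/
def cliffordPart : Set X := ⋃ e ∈ idemSet X, maxSubgroup X e

/-- `H_e/e := {x : xe = ex ∈ H_e}`. -/
def HeCoideal (e : X) : Set X := {x | x * e = e * x ∧ x * e ∈ maxSubgroup X e}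

/-- `I` is an ideal of the semigroup `X`. -/
def IsIdealSet (I : Set X) : Prop := ∀ x ∈ I, ∀ y : X, x * y ∈ I ∧ y * x ∈ I

/-- The set `VE(X)` of viable idempotents: `e` is idempotent and `X ∖ (H_e/e)` is an ideal. -/
def viableIdems : Set X := {e | e ∈ idemSet X ∧ IsIdealSet X (Set.univ \ HeCoideal X e)}

/-- The center `Z(X)`. -/
def centerSet : Set X := {z | ∀ x, z * x = x * z}

/-- `√A = {x : xⁿ ∈ A for some n ≥ 1}`. -/
def sqrtSet (A : Set X) : Set X := {x | ∃ n : ℕ, spow x n ∈ A}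

/-- A subset `B ⊆ X` is bounded: there is `n ≥ 1` with `xⁿ` idempotent for all `x ∈ B`. -/
def BoundedSet (B : Set X) : Prop := ∃ n : ℕ, ∀ x ∈ B, spow x n ∈ idemSet X

/-- The semigroup `X` is bounded. -/
def BoundedSemigroup : Prop := ∃ n : ℕ, ∀ x : X, spow x n ∈ idemSet X

/-- `X` is chain-finite. -/
def ChainFinite : Prop :=
  ∀ I : Set X, I.Infinite → ∃ x ∈ I, ∃ y ∈ I, x * y ≠ x ∧ x * y ≠ y

/-- `G ⊆ X` is a subgroup of the semigroup `X`. -/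
def IsSubgroupSet (G : Set X) : Prop :=
  (∀ x ∈ G, ∀ y ∈ G, x * y ∈ G) ∧
    ∃ e ∈ G, (∀ x ∈ G, x * e = x ∧ e * x = x) ∧ ∀ x ∈ G, ∃ y ∈ G, x * y = e ∧ y * x = e

/-- `X` is group-finite: all its subgroups are finite. -/
def GroupFinite : Prop := ∀ G : Set X, IsSubgroupSet X G → G.Finite

/-- `X` is Clifford+finite: `X ∖ H(X)` is finite. -/
def CliffordPlusFinite : Prop := (Set.univ \ cliffordPart X).Finite

/-- `X` is `E`-commutative: idempotents commute. -/
def ECommutative : Prop := ∀ x ∈ idemSet X, ∀ y ∈ idemSet X, x * y = y * x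

end AlgDefs

/-- The Rees congruence associated with an ideal `I` of `X`. -/
def ReesCon {X : Type*} [Semigroup X] (I : Set X) (hI : IsIdealSet X I) : Con X where
  r x y := x = y ∨ (x ∈ I ∧ y ∈ I)
  iseqv :=
    { refl := fun _ => Or.inl rfl
      symm := by rintro x y (rfl | ⟨h1, h2⟩); exacts [Or.inl rfl, Or.inr ⟨h2, h1⟩]
      trans := by
        rintro x y z (rfl | ⟨h1, h2⟩) (rfl | ⟨h3, h4⟩)
        exacts [Or.inl rfl, Or.inr ⟨h3, h4⟩, Or.inr ⟨h1, h2⟩, Or.inr ⟨h1, h4⟩] }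
  mul' := by
    rintro a b c d (rfl | ⟨h1, h2⟩) (rfl | ⟨h3, h4⟩)
    · exact Or.inl rfl
    · exact Or.inr ⟨(hI c h3 a).2, (hI d h4 a).2⟩
    · exact Or.inr ⟨(hI a h1 c).1, (hI b h2 c).1⟩
    · exact Or.inr ⟨(hI a h1 c).1, (hI b h2 d).1⟩

/-- `X` is ideally `T₂S`-closed: all its Rees quotients are `T₂S`-closed. -/
def IdeallyT2SClosed (X : Type u) [Semigroup X] : Prop :=
  ∀ (I : Set X) (hI : IsIdealSet X I), T2SClosed (ReesCon I hI).Quotient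

/-- `X` is ideally `TzS`-closed. -/
def IdeallyTzSClosed (X : Type u) [Semigroup X] : Prop :=
  ∀ (I : Set X) (hI : IsIdealSet X I), TzSClosed (ReesCon I hI).Quotient

/-- A congruence is a semilattice congruence if its quotient is a commutative
semigroup of idempotents. -/
def IsSemilatticeCon {X : Type*} [Semigroup X] (c : Con X) : Prop :=
  (∀ a b : c.Quotient, a * b = b * a) ∧ ∀ a : c.Quotient, a * a = a

/-- The smallest semilattice congruence `⇕` on `X`, the intersection of all
semilattice congruences. -/
def slCon (X : Type*) [Semigroup X] : Con X := sInf {c | IsSemilatticeCon c}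

theorem centerSet_mul_mem {X : Type*} [Semigroup X] {a b : X}
    (ha : a ∈ centerSet X) (hb : b ∈ centerSet X) : a * b ∈ centerSet X := fun t => by
  rw [mul_assoc, hb t, ← mul_assoc, ha t, mul_assoc]

/-- The ideal center `IZ(X) = {z ∈ Z(X) : zX ⊆ Z(X)}`, as a subsemigroup of `X`. -/
def idealCenter (X : Type*) [Semigroup X] : Subsemigroup X where
  carrier := {z | z ∈ centerSet X ∧ ∀ x : X, z * x ∈ centerSet X}
  mul_mem' := by
    rintro a b ⟨ha, ha'⟩ ⟨hb, hb'⟩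
    refine ⟨centerSet_mul_mem ha hb, fun x => ?_⟩
    have h : a * b * x = a * (b * x) := mul_assoc a b x
    rw [h]
    exact centerSet_mul_mem ha (hb' x)

/-- Evaluation of the semigroup polynomial with coefficients `a, l = [a₁, …, aₙ]`:
`x ↦ a * x * a₁ * x * ⋯ * x * aₙ` (computed in `X¹ = WithOne X`). -/
def polyEval {X : Type*} [Semigroup X] (a : WithOne X) (l : List (WithOne X)) (x : X) :
    WithOne X :=
  l.foldl (fun acc b => acc * (x : WithOne X) * b) a

/-- `f : X → X¹` is a semigroup polynomial of degree `d ≥ 1`. -/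
def IsSemigroupPolynomial {X : Type*} [Semigroup X] (f : X → WithOne X) (d : ℕ) : Prop :=
  1 ≤ d ∧ ∃ (a : WithOne X) (l : List (WithOne X)), l.length = d ∧ ∀ x, f x = polyEval a l x

/-- `X` is polybounded. -/
def Polybounded (X : Type*) [Semigroup X] : Prop :=
  ∃ (k : ℕ) (f : Fin k → X → WithOne X) (d : Fin k → ℕ) (b : Fin k → X),
    (∀ i, IsSemigroupPolynomial (f i) (d i)) ∧ ∀ x : X, ∃ i, f i x = (b i : WithOne X)

/-- `X` is polyfinite. -/
def Polyfinite (X : Type*) [Semigroup X] : Prop :=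
  ∃ (d : ℕ) (F : Set X), F.Finite ∧ ∀ x y : X,
    ∃ (f : X → WithOne X) (m : ℕ), m ≤ d ∧ IsSemigroupPolynomial f m ∧
      (∃ u ∈ F, f x = (u : WithOne X)) ∧ ∃ v ∈ F, f y = (v : WithOne X)

/-- `X` is `B`-centrobounded over `B ⊆ E(X)`: there is `n ≥ 1` such that for every
`e ∈ B` and all `x, y ∈ ⋂_{a ∈ B} H_a/a`, if `w` is the inverse of `y*e` in the group
`H_e` and `(x*e)*w ∈ H_e ∩ Z(X)`, then `((x*e)*w)ⁿ` is an idempotent. -/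
def Centrobounded {X : Type*} [Semigroup X] (B : Set X) : Prop :=
  ∃ n : ℕ, ∀ e ∈ B, ∀ x ∈ ⋂ a ∈ B, HeCoideal X a, ∀ y ∈ ⋂ a ∈ B, HeCoideal X a,
    ∀ w ∈ maxSubgroup X e, (y * e) * w = e → w * (y * e) = e →
      (x * e) * w ∈ maxSubgroup X e → (x * e) * w ∈ centerSet X →
        spow ((x * e) * w) n ∈ idemSet X

/-- `B` is an antichain in the natural partial order `e ≤ f ⇔ ef = fe = e` on idempotents. -/
def IsIdemAntichain {X : Type*} [Semigroup X] (B : Set X) : Prop :=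
  ∀ e ∈ B, ∀ f ∈ B, e ≠ f → ¬(e * f = e ∧ f * e = e) ∧ ¬(e * f = f ∧ f * e = f)

open Filter Topology

section Powers

variable {X : Type*} [Semigroup X]

theorem spow_mul_spow (x : X) (m n : ℕ) : spow x m * spow x n = spow x (m + n + 1) := by
  induction n with
  | zero => rfl
  | succ n ih => rw [spow, ← mul_assoc, ih]; rfl

theorem map_spow {Y F : Type*} [Semigroup Y] [FunLike F X Y] [MulHomClass F X Y] (f : F) (x : X)
    (n : ℕ) : f (spow x n) = spow (f x) n := by
  induction n with
  | zero => rfl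
  | succ n ih => rw [spow, map_mul, ih, spow]

theorem spow_eq_pow {M : Type*} [Monoid M] (x : M) (n : ℕ) : spow x n = x ^ (n + 1) := by
  induction n with
  | zero => simp [spow]
  | succ n ih => rw [spow, ih, ← pow_succ]

theorem spow_spow (x : X) (m n : ℕ) : spow (spow x m) n = spow x ((m + 1) * (n + 1) - 1) := by
  induction n with
  | zero => simp [spow]
  | succ n ih =>
    rw [spow, ih, spow_mul_spow]
    congr 1
    have : 1 ≤ (m + 1) * (n + 1) := Nat.mul_pos (by simp) (by simp)
    rw [mul_add (m + 1) (n + 1) 1]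
    omega

theorem spow_of_idem {x : X} (hx : x * x = x) (n : ℕ) : spow x n = x := by
  induction n with
  | zero => rfl
  | succ n ih => rw [spow, ih, hx]

/-- Two idempotent powers of an element coincide. -/
theorem spow_eq_spow_of_idem {x : X} {m n : ℕ} (hm : spow x m * spow x m = spow x m)
    (hn : spow x n * spow x n = spow x n) : spow x m = spow x n := by
  rw [← spow_of_idem hm n, ← spow_of_idem hn m, spow_spow, spow_spow, mul_comm]

theorem spow_mul_of_mul_eq {e x : X} (h : e * x = x) (n : ℕ) : e * spow x n = spow x n := by
  induction n with
  | zero => exact h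
  | succ n ih => rw [spow, ← mul_assoc, ih]

theorem mul_spow_of_central {c : X} (hc : ∀ x, c * x = x * c) (x : X) (n : ℕ) :
    spow (c * x) n = spow c n * spow x n := by
  induction n with
  | zero => rfl
  | succ n ih =>
    have h : spow x n * (c * x) = c * (spow x n * x) := by
      rw [← mul_assoc, ← hc, mul_assoc]
    rw [spow, ih, spow, spow, mul_assoc, h, mul_assoc]

end Powers

section ClopenBasis

theorem hasClopenBasis_of_nhds {Y : Type*} [TopologicalSpace Y]
    (h : ∀ y : Y, ∀ s ∈ 𝓝 y, ∃ t, IsClopen t ∧ y ∈ t ∧ t ⊆ s) : HasClopenBasis Y :=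
  ⟨{s | IsClopen s}, fun _ hs => hs, isTopologicalBasis_of_isOpen_of_nhds (fun _ hs => hs.isOpen)
    fun y s hy hs => by
      obtain ⟨t, ht, hyt, hts⟩ := h y s (hs.mem_nhds hy)
      exact ⟨t, ht, hyt, hts⟩⟩

theorem HasClopenBasis.exists_subset {Y : Type*} [TopologicalSpace Y] (h : HasClopenBasis Y)
    {y : Y} {s : Set Y} (hs : s ∈ 𝓝 y) : ∃ t, IsClopen t ∧ y ∈ t ∧ t ⊆ s := by
  obtain ⟨B, hB, hb⟩ := h
  obtain ⟨t, htB, hyt, hts⟩ := hb.mem_nhds_iff.1 hs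
  exact ⟨t, hB t htB, hyt, hts⟩

theorem HasClopenBasis.of_isInducing {Y Z : Type*} [TopologicalSpace Y] [TopologicalSpace Z]
    {f : Y → Z} (hf : IsInducing f) (h : HasClopenBasis Z) : HasClopenBasis Y :=
  hasClopenBasis_of_nhds fun y s hs => by
    rw [hf.nhds_eq_comap, mem_comap] at hs
    obtain ⟨u, hu, hus⟩ := hs
    obtain ⟨t, ht, hyt, htu⟩ := h.exists_subset hu
    exact ⟨f ⁻¹' t, ht.preimage hf.continuous, hyt, (preimage_mono htu).trans hus⟩

theorem hasClopenBasis_of_discrete (Y : Type*) [TopologicalSpace Y] [DiscreteTopology Y] :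
    HasClopenBasis Y :=
  hasClopenBasis_of_nhds fun y _ hs =>
    ⟨{y}, isClopen_discrete _, rfl, singleton_subset_iff.2 (mem_of_mem_nhds hs)⟩

theorem HasClopenBasis.pi {ι : Type*} {Y : ι → Type*} [∀ i, TopologicalSpace (Y i)]
    (h : ∀ i, HasClopenBasis (Y i)) : HasClopenBasis (∀ i, Y i) := by
  choose B hB hb using h
  refine ⟨_, ?_, isTopologicalBasis_pi hb⟩
  rintro _ ⟨U, F, hU, rfl⟩
  exact ⟨isClosed_set_pi fun i hi => (hB i _ (hU i hi)).isClosed,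
    isOpen_set_pi F.finite_toSet fun i hi => (hB i _ (hU i hi)).isOpen⟩

/-- A countable metric space is zero-dimensional. -/
theorem hasClopenBasis_of_countable (Y : Type*) [MetricSpace Y] [Countable Y] :
    HasClopenBasis Y :=
  hasClopenBasis_of_nhds fun y s hs => by
    obtain ⟨ε, hε, hs⟩ := Metric.mem_nhds_iff.1 hs
    have hc : (Set.range fun z => dist z y).Countable := countable_range _
    obtain ⟨r, hr, hr'⟩ : ∃ r ∈ Ioo 0 ε, r ∉ Set.range fun z => dist z y := by
      by_contra! hcon
      exact (Cardinal.Real.Ioo_countable_iff.1 (hc.mono hcon)).not_gt hε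
    refine ⟨Metric.ball y r, ⟨?_, Metric.isOpen_ball⟩, Metric.mem_ball_self hr.1,
      (Metric.ball_subset_ball hr.2.le).trans hs⟩
    have : Metric.ball y r = Metric.closedBall y r := by
      ext z
      refine ⟨fun h => Metric.ball_subset_closedBall h, fun h => lt_of_le_of_ne (α := ℝ) h ?_⟩
      exact fun h' => hr' ⟨z, h'⟩
    rw [this]
    exact Metric.isClosed_closedBall

end ClopenBasis

section Closedness

variable {X : Type u} [Semigroup X]

theorem AbsolutelyTzSClosed.of_surjective (hX : AbsolutelyTzSClosed X) {X' : Type u} [Semigroup X']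
    (f : X →ₙ* X') (hf : Function.Surjective f) : AbsolutelyTzSClosed X' := by
  intro Y _ _ _ _ hY h
  have := hX Y hY (h.comp f)
  rwa [MulHom.coe_comp, hf.range_comp] at this

/-- If the values of `T` are limits of the values of a family of homomorphisms to discrete
semigroups, then they are attained at a single point. -/
theorem AbsolutelyTzSClosed.exists_eq_of_eventually (hX : AbsolutelyTzSClosed X) {ι : Type u}
    {Y : ι → Type u} [∀ i, Semigroup (Y i)] (h : ∀ i, X →ₙ* Y i) {α : Type*} (l : Filter α)
    [l.NeBot] (c : α → X) (T : ∀ i, Y i) (hT : ∀ i, ∀ᶠ a in l, h i (c a) = T i) :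
    ∃ x, ∀ i, h i x = T i := by
  let _ : ∀ i, TopologicalSpace (Y i) := fun _ => ⊥
  have _ : ∀ i, DiscreteTopology (Y i) := fun _ => ⟨rfl⟩
  have hc := hX (∀ i, Y i) (HasClopenBasis.pi fun i => hasClopenBasis_of_discrete _) (MulHom.pi h)
  have hlim : Tendsto (fun a => MulHom.pi h (c a)) l (𝓝 T) :=
    tendsto_pi_nhds.2 fun i => tendsto_nhds_of_eventually_eq (hT i)
  obtain ⟨x, hx⟩ := hc.mem_of_tendsto hlim (Eventually.of_forall fun a => mem_range_self _)
  exact ⟨x, fun i => congrFun hx i⟩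

/-- Multiplicative predicates are closed under limits. -/
theorem AbsolutelyTzSClosed.exists_iff_of_eventually (hX : AbsolutelyTzSClosed X) {ι : Type}
    (P : ι → X → Prop) (hP : ∀ i x y, P i (x * y) ↔ P i x ∧ P i y) {α : Type*} (l : Filter α)
    [l.NeBot] (c : α → X) (T : ι → Prop) (hT : ∀ i, ∀ᶠ a in l, (P i (c a) ↔ T i)) :
    ∃ x, ∀ i, P i x ↔ T i := by
  classical
  obtain ⟨x, hx⟩ := hX.exists_eq_of_eventually (ι := ULift.{u} ι) (Y := fun _ => ULift.{u} ℕ)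
    (fun i => { toFun := fun x => ⟨if P i.down x then 1 else 0⟩
                map_mul' := fun x y => by
                  ext
                  by_cases h1 : P i.down x <;> by_cases h2 : P i.down y <;> simp [hP, h1, h2] })
    l c (fun i => ⟨if T i.down then 1 else 0⟩) (fun i => (hT i.down).mono fun a ha => by
      by_cases h : T i.down <;> simp_all)
  refine ⟨x, fun i => ?_⟩
  have := congrArg ULift.down (hx ⟨i⟩)
  by_cases h1 : P i x <;> by_cases h2 : T i <;> simp_all

/-- A homomorphism to a group with zero, followed by quotient maps. -/
theorem AbsolutelyTzSClosed.exists_mem_of_eventually (hX : AbsolutelyTzSClosed X) {G : Type u}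
    [CommGroup G] (φ : X →ₙ* WithZero G) {ι : Type u} [Nonempty ι] (N : ι → Subgroup G)
    {α : Type*} (l : Filter α) [l.NeBot] (c : α → G) (hc : ∀ a, ∃ x, φ x = c a) (T : ι → G)
    (hT : ∀ i, ∀ᶠ a in l, (c a)⁻¹ * T i ∈ N i) :
    ∃ x, ∃ g : G, φ x = g ∧ ∀ i, g⁻¹ * T i ∈ N i := by
  choose d hd using hc
  obtain ⟨x, hx⟩ := hX.exists_eq_of_eventually (Y := fun i => WithZero (G ⧸ N i))
    (fun i => (WithZero.map' (QuotientGroup.mk' (N i))).toMonoidHom.toMulHom.comp φ) l d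
    (fun i => ((T i : G ⧸ N i) : WithZero _)) (fun i => (hT i).mono fun a ha => by
      refine (congrArg (WithZero.map' (QuotientGroup.mk' (N i))) (hd a)).trans ?_
      exact congrArg WithZero.coe (QuotientGroup.eq.2 ha))
  have hx (i : ι) : WithZero.map' (QuotientGroup.mk' (N i)) (φ x) = (T i : G ⧸ N i) := hx i
  have hne : φ x ≠ 0 := fun h => by
    have := hx (Classical.arbitrary ι)
    simp [h] at this
  obtain ⟨g, hg⟩ := WithZero.ne_zero_iff_exists.1 hne
  refine ⟨x, g, hg.symm, fun i => QuotientGroup.eq.1 ?_⟩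
  have := hx i
  rw [← hg] at this
  exact WithZero.coe_injective this

end Closedness

section IdealCenter

variable {X : Type u} [Semigroup X]

theorem mul_comm_of_mem_idealCenter {z : X} (hz : z ∈ idealCenter X) (x : X) : z * x = x * z :=
  hz.1 x

theorem mul_mem_idealCenter {z : X} (hz : z ∈ idealCenter X) (x : X) : z * x ∈ idealCenter X :=
  ⟨hz.2 x, fun y => by rw [mul_assoc]; exact hz.2 (x * y)⟩

theorem spow_mem_idealCenter {z : X} (hz : z ∈ idealCenter X) (n : ℕ) :
    spow z n ∈ idealCenter X := by
  induction n with
  | zero => exact hz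
  | succ n ih => exact mul_mem ih hz

instance : CommSemigroup (idealCenter X) where
  mul_comm a b := Subtype.ext (mul_comm_of_mem_idealCenter a.2 b)

end IdealCenter

section Localization

open Classical in
/-- The homomorphism of a commutative monoid to its group of units with zero adjoined that
annihilates all non-units. -/
noncomputable def unitsWithZero (L : Type*) [CommMonoid L] : L →ₙ* WithZero Lˣ where
  toFun a := if h : IsUnit a then (h.unit : WithZero Lˣ) else 0
  map_mul' a b := by
    by_cases ha : IsUnit a <;> by_cases hb : IsUnit b
    · have hab : IsUnit (a * b) := ha.mul hb
      rw [dif_pos ha, dif_pos hb, dif_pos hab, ← WithZero.coe_mul]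
      exact congrArg WithZero.coe (Units.ext rfl)
    all_goals simp [ha, hb]

theorem unitsWithZero_of_isUnit {L : Type*} [CommMonoid L] {a : L} (h : IsUnit a) :
    unitsWithZero L a = (h.unit : WithZero Lˣ) := dif_pos h

theorem isUnit_of_unitsWithZero_ne {L : Type*} [CommMonoid L] {a : L}
    (h : unitsWithZero L a ≠ 0) : IsUnit a := by
  by_contra h'
  exact h (dif_neg h')

theorem WithOne.coe_spow {S : Type*} [CommSemigroup S] (z : S) (n : ℕ) :
    ((spow z n : S) : WithOne S) = (z : WithOne S) ^ (n + 1) := by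
  rw [← spow_eq_pow]
  exact map_spow WithOne.coeMulHom z n

variable {X : Type u} [Semigroup X]

/-- Inverting an element of the ideal center yields a homomorphism to a group with zero. -/
theorem exists_localization {z : X} (hz : z ∈ idealCenter X) :
    ∃ (G : Type u) (_ : CommGroup G) (φ : X →ₙ* WithZero G), φ z ≠ 0 ∧
      (∀ x y, φ x ≠ 0 → φ x = φ y → ∃ n, spow z n * x = spow z n * y) ∧
      (∀ x, φ x ≠ 0 → ∃ y ∈ idealCenter X, ∃ n, x * y = spow z n) ∧
      (z * z = z → ∀ g : G, ∃ x ∈ idealCenter X, φ x = g) := by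
  let z' : idealCenter X := ⟨z, hz⟩
  let t : WithOne (idealCenter X) := z'
  have hcoe (n : ℕ) : ((spow z' n : idealCenter X) : X) = spow z n :=
    map_spow (MulMemClass.subtype (idealCenter X)) z' n
  let τ : Submonoid.powers t := ⟨t, Submonoid.mem_powers t⟩
  let mz (x : X) : idealCenter X := ⟨z * x, mul_mem_idealCenter hz x⟩
  have hmz (x y : X) : mz x * mz y = z' * mz (x * y) := Subtype.ext <| by
    change z * x * (z * y) = z * (z * (x * y))
    rw [← mul_assoc (z * x) z y, ← mul_comm_of_mem_idealCenter hz (z * x), mul_assoc, mul_assoc]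
  let ρ : X →ₙ* Localization (Submonoid.powers t) :=
    { toFun := fun x => Localization.mk (mz x : WithOne _) τ
      map_mul' := fun x y => by
        rw [Localization.mk_mul, Localization.mk_eq_mk_iff, Localization.r_iff_exists]
        refine ⟨1, ?_⟩
        have := congrArg (WithOne.coe : _ → WithOne (idealCenter X)) (hmz x y)
        simp only [WithOne.coe_mul] at this
        change 1 * (t * t * (mz (x * y) : WithOne _)) =
          1 * (t * (WithOne.coe (mz x) * WithOne.coe (mz y)))
        rw [this, mul_assoc] }
  have hunit {x : X} (h : unitsWithZero _ (ρ x) ≠ 0) : IsUnit (ρ x) :=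
    isUnit_of_unitsWithZero_ne h
  refine ⟨(Localization (Submonoid.powers t))ˣ, inferInstance, (unitsWithZero _).comp ρ,
    ?_, ?_, ?_, ?_⟩
  · have h : IsUnit (ρ z) := by
      refine IsUnit.of_mul_eq_one (Localization.mk t (τ * τ)) ?_
      change Localization.mk (t * t) τ * _ = _
      rw [Localization.mk_mul, mul_assoc]
      exact Localization.mk_self (τ * (τ * τ))
    rw [MulHom.comp_apply, unitsWithZero_of_isUnit h]
    exact WithZero.coe_ne_zero
  · intro x y hx hxy
    rw [MulHom.comp_apply] at hx
    have h1 := hunit hx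
    have h2 : IsUnit (ρ y) := hunit (by rw [← MulHom.comp_apply, ← hxy]; exact hx)
    rw [MulHom.comp_apply, MulHom.comp_apply, unitsWithZero_of_isUnit h1,
      unitsWithZero_of_isUnit h2, WithZero.coe_inj, Units.ext_iff] at hxy
    obtain ⟨⟨_, n, rfl⟩, hc⟩ := Localization.r_iff_exists.1 (Localization.mk_eq_mk_iff.1 hxy)
    refine ⟨n + 1, ?_⟩
    change t ^ n * (t * (mz x : WithOne _)) = t ^ n * (t * (mz y : WithOne _)) at hc
    rw [← mul_assoc, ← mul_assoc, ← pow_succ, ← WithOne.coe_spow, ← WithOne.coe_mul, ← WithOne.coe_mul,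
      WithOne.coe_inj, Subtype.ext_iff] at hc
    have h : spow z n * (z * x) = spow z n * (z * y) := by
      rw [← hcoe]
      exact hc
    rwa [← mul_assoc, ← mul_assoc] at h
  · intro x hx
    obtain ⟨w, hw⟩ := (hunit hx).exists_right_inv
    obtain ⟨⟨a, ⟨_, j, rfl⟩⟩, rfl⟩ := Localization.mkHom_surjective w
    change Localization.mk _ _ * Localization.mk _ _ = _ at hw
    rw [Localization.mk_mul, ← Localization.mk_one, Localization.mk_eq_mk_iff,
      Localization.r_iff_exists] at hw
    obtain ⟨⟨_, i, rfl⟩, hc⟩ := hw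
    change t ^ i * (1 * (mz x * a)) = t ^ i * (t * t ^ j * 1) at hc
    obtain ⟨b, hb⟩ : ∃ b : idealCenter X, (b : WithOne _) = a * t := by
      induction a with
      | one => exact ⟨z', by simp [t]⟩
      | coe a => exact ⟨a * z', by simp [t]⟩
    have h : spow z' i * (mz x * b) = spow z' (i + j + 2) := by
      rw [← WithOne.coe_inj, WithOne.coe_mul, WithOne.coe_mul, WithOne.coe_spow, WithOne.coe_spow, hb]
      change t ^ (i + 1) * _ = t ^ (i + j + 2 + 1)
      calc _ = (t ^ i * (1 * (mz x * a))) * t * t := by rw [pow_succ, one_mul]; ac_rfl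
        _ = _ := by rw [hc, mul_one, ← pow_succ' t j, ← pow_add, ← pow_succ, ← pow_succ]; congr 1
    refine ⟨spow z (i + 1) * b, mul_mem (spow_mem_idealCenter hz _) b.2, i + j + 2, ?_⟩
    rw [← hcoe (i + j + 2), ← h]
    change _ = _ * (z * x * b)
    rw [hcoe, ← mul_assoc, ← mul_comm_of_mem_idealCenter (spow_mem_idealCenter hz _), spow]
    simp only [mul_assoc]
  · intro hzz g
    obtain ⟨⟨a, ⟨_, j, rfl⟩⟩, hw⟩ := Localization.mkHom_surjective g.val
    obtain ⟨b, hb⟩ : ∃ b : idealCenter X, (b : WithOne _) = a * t := by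
      induction a with
      | one => exact ⟨z', by simp [t]⟩
      | coe a => exact ⟨a * z', by simp [t]⟩
    have htt : t * t = t := congrArg WithOne.coe (Subtype.ext hzz : z' * z' = z')
    have htj : t * t ^ j = t := by
      rw [← pow_succ', ← WithOne.coe_spow, spow_of_idem (Subtype.ext hzz)]
    have hmb : ((mz b : idealCenter X) : WithOne (idealCenter X)) = t * (b : idealCenter X) :=
      congrArg WithOne.coe (Subtype.ext rfl : mz b = z' * b)
    have hρ : ρ b = g.val := by
      rw [← hw]
      refine Localization.mk_eq_mk_iff.2 (Localization.r_iff_exists.2 ⟨τ, ?_⟩)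
      change t * (t ^ j * (mz b : WithOne _)) = t * (t * a)
      rw [← mul_assoc, htj, hmb, hb, mul_comm a]
      simp only [← mul_assoc, htt]
    have hu : IsUnit (ρ b) := hρ ▸ g.isUnit
    exact ⟨b, b.2, (unitsWithZero_of_isUnit hu).trans (congrArg WithZero.coe (Units.ext hρ))⟩

end Localization

section Periodic

theorem exists_spow_idem_of_eq {X : Type*} [Semigroup X] {x : X} {i k : ℕ} (hk : 0 < k)
    (h : spow x i = spow x (i + k)) : ∃ n, spow x n * spow x n = spow x n := by
  have h1 (m : ℕ) : spow x (i + m) = spow x (i + m + k) := by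
    cases m with
    | zero => exact h
    | succ m => rw [← add_assoc, ← spow_mul_spow, h, spow_mul_spow]; congr 1; omega
  have h2 (m j : ℕ) : spow x (i + m) = spow x (i + m + j * k) := by
    induction j with
    | zero => simp
    | succ j ih => rw [ih, add_assoc i m, h1]; congr 1; ring
  have hle : i + 1 ≤ (i + 1) * k := Nat.le_mul_of_pos_right _ hk
  obtain ⟨m, hm⟩ := Nat.exists_eq_add_of_le hle
  refine ⟨i + m, ?_⟩
  rw [spow_mul_spow, h2 m (i + 1), hm]
  congr 1
  ring

variable {X : Type u} [Semigroup X]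

theorem AbsolutelyTzSClosed.isOfFinOrder (hX : AbsolutelyTzSClosed X) {G : Type u} [CommGroup G]
    (φ : X →ₙ* WithZero G) {x : X} {g : G} (hx : φ x = g) : IsOfFinOrder g := by
  let s (n : ℕ) : ℕ := ∑ k ∈ Finset.range (n + 1), 3 ^ k
  have hs (n : ℕ) : 2 * (s n : ℤ) + 1 = 3 ^ (n + 1) := by
    induction n with
    | zero => simp [s]
    | succ n ih =>
      have : s (n + 1) = s n + 3 ^ (n + 1) := Finset.sum_range_succ _ _
      rw [this]
      push_cast
      linear_combination ih
  have hs1 (n : ℕ) : 1 ≤ s n := by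
    have := hs n
    have h3 : (3 : ℤ) ^ 1 ≤ 3 ^ (n + 1) := pow_le_pow_right₀ (by norm_num) (by omega)
    omega
  obtain ⟨y, g', -, hg'⟩ := hX.exists_mem_of_eventually φ
    (fun n : ULift.{u} ℕ => Subgroup.zpowers (g ^ 3 ^ (n.down + 1))) atTop (fun n => g ^ s n)
    (fun n => ⟨spow x (s n - 1), by
      rw [map_spow, hx, spow_eq_pow, Nat.sub_add_cancel (hs1 n), WithZero.coe_pow]⟩)
    (fun n => g ^ s n.down) (fun n => (eventually_ge_atTop n.down).mono fun a ha => by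
      have hd : (3 : ℤ) ^ (n.down + 1) ∣ s n.down - s a := by
        have h2 : (3 : ℤ) ^ (n.down + 1) ∣ 2 * (s n.down - s a) := by
          rw [show 2 * ((s n.down : ℤ) - s a) = 3 ^ (n.down + 1) - 3 ^ (a + 1) by
            rw [← hs, ← hs]; ring]
          exact dvd_sub dvd_rfl (pow_dvd_pow 3 (by omega))
        exact IsCoprime.dvd_of_dvd_mul_left (IsCoprime.pow_left (by norm_num)) h2
      obtain ⟨m, hm⟩ := hd
      refine Subgroup.mem_zpowers_iff.2 ⟨m, ?_⟩
      rw [← zpow_natCast g (s a), ← zpow_natCast g (s n.down), ← zpow_neg, ← zpow_add,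
        ← zpow_natCast g (3 ^ _), ← zpow_mul, neg_add_eq_sub, hm]
      push_cast
      rfl)
  by_contra hinf
  have hinj := injective_zpow_iff_not_isOfFinOrder.2 hinf
  have hg (n : ℕ) : ∃ m : ℤ, g' = g ^ (s n - m * 3 ^ (n + 1)) := by
    obtain ⟨m, hm⟩ := Subgroup.mem_zpowers_iff.1 (hg' ⟨n⟩)
    refine ⟨m, ?_⟩
    rw [eq_inv_mul_iff_mul_eq, ← eq_mul_inv_iff_mul_eq] at hm
    rw [hm, zpow_sub, zpow_natCast, ← zpow_natCast g (3 ^ _), ← zpow_mul, mul_comm m]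
    push_cast
    rfl
  obtain ⟨m₀, hm₀⟩ := hg 0
  have hdvd (n : ℕ) : (3 : ℤ) ^ (n + 1) ∣ 2 * (s 0 - m₀ * 3 ^ (0 + 1)) + 1 := by
    obtain ⟨m, hm⟩ := hg n
    rw [hinj (hm₀.symm.trans hm)]
    exact ⟨1 - 2 * m, by linear_combination hs n⟩
  have hne : 2 * ((s 0 : ℤ) - m₀ * 3 ^ (0 + 1)) + 1 ≠ 0 := by omega
  have := Int.le_of_dvd (abs_pos.2 hne) ((dvd_abs _ _).2
    (hdvd (2 * ((s 0 : ℤ) - m₀ * 3 ^ (0 + 1)) + 1).natAbs))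
  rw [Int.abs_eq_natAbs] at this
  have h3 := Nat.lt_pow_self (n := (2 * ((s 0 : ℤ) - m₀ * 3 ^ (0 + 1)) + 1).natAbs)
    (show 1 < 3 by norm_num)
  have h4 := Nat.pow_le_pow_right (show 0 < 3 by norm_num)
    (Nat.le_add_right (2 * ((s 0 : ℤ) - m₀ * 3 ^ (0 + 1)) + 1).natAbs 1)
  exact absurd (h3.trans_le h4) (not_lt.2 (by exact_mod_cast this))

/-- Elements of the ideal center are periodic. -/
theorem AbsolutelyTzSClosed.exists_spow_idem (hX : AbsolutelyTzSClosed X) {z : X}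
    (hz : z ∈ idealCenter X) : ∃ n, spow z n * spow z n = spow z n := by
  obtain ⟨G, _, φ, hφz, hφ, -, -⟩ := exists_localization hz
  obtain ⟨g, hg⟩ := WithZero.ne_zero_iff_exists.1 hφz
  obtain ⟨k, hk, hgk⟩ := isOfFinOrder_iff_pow_eq_one.1 (hX.isOfFinOrder φ hg.symm)
  have h1 (j : ℕ) : φ (spow z (k * (j + 1) - 1)) = 1 := by
    rw [map_spow, ← hg, spow_eq_pow, Nat.sub_add_cancel (Nat.mul_pos hk j.succ_pos),
      ← WithZero.coe_pow, pow_mul, hgk, one_pow, WithZero.coe_one]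
  obtain ⟨n, hn⟩ := hφ _ _ (by rw [h1 0]; exact one_ne_zero) ((h1 0).trans (h1 1).symm)
  rw [spow_mul_spow, spow_mul_spow] at hn
  refine exists_spow_idem_of_eq hk (hn.trans ?_)
  congr 1
  omega

theorem AbsolutelyTzSClosed.exists_spow_map_idem (hX : AbsolutelyTzSClosed X) {C : Type u}
    [CommSemigroup C] (f : X →ₙ* C) (x : X) :
    ∃ n, spow (f x) n * spow (f x) n = spow (f x) n := by
  have hQ := hX.of_surjective f.srangeRestrict f.srangeRestrict_surjective
  have hmem : f.srangeRestrict x ∈ idealCenter f.srange :=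
    ⟨fun _ => Subtype.ext (mul_comm _ _), fun _ _ => Subtype.ext (mul_comm _ _)⟩
  obtain ⟨n, hn⟩ := hQ.exists_spow_idem hmem
  refine ⟨n, ?_⟩
  have := congrArg (MulMemClass.subtype f.srange) hn
  rwa [map_mul, map_spow] at this

end Periodic

section Idempotents

/-- The idempotents of a commutative semigroup, ordered by `e ≤ f ↔ e * f = e`. -/
structure Idem (T : Type*) [CommSemigroup T] where
  val : T
  idem : val * val = val

namespace Idem

variable {T : Type*} [CommSemigroup T]

instance : PartialOrder (Idem T) where
  le e f := e.1 * f.1 = e.1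
  le_refl e := e.2
  le_trans e f g hef hfg := by
    rw [← hef, mul_assoc, hfg]
  le_antisymm e f hef hfe := by
    have h : e.val = f.val := by rw [← hef, mul_comm, hfe]
    cases e
    cases f
    cases h
    rfl

instance : SemilatticeInf (Idem T) where
  inf e f := ⟨e.1 * f.1, by rw [mul_mul_mul_comm, e.2, f.2]⟩
  inf_le_left e f := by
    change e.1 * f.1 * e.1 = e.1 * f.1
    rw [mul_comm, ← mul_assoc, e.2]
  inf_le_right e f := by
    change e.1 * f.1 * f.1 = e.1 * f.1
    rw [mul_assoc, f.2]
  le_inf e f g hf hg := by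
    change e.1 * (f.1 * g.1) = e.1
    rw [← mul_assoc, hf, hg]

theorem inf_val (e f : Idem T) : (e ⊓ f).1 = e.1 * f.1 := rfl

end Idem

theorem exists_constant_or_antichain {P : Type*} [PartialOrder P] [WellFoundedLT P]
    [WellFoundedGT P] (c : ℕ → P) :
    ∃ g : ℕ → ℕ, StrictMono g ∧
      ((∀ n, c (g n) = c (g 0)) ∨ ∀ m n, m ≠ n → ¬ c (g m) ≤ c (g n)) := by
  obtain ⟨g₁, h₁ | h₁⟩ := exists_increasing_or_nonincreasing_subseq (· < ·) c
  · exact ((wellFounded_iff_isEmpty_descending_chain.1 (wellFounded_gt (α := P))).false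
      ⟨fun n => c (g₁ n), fun n => h₁ n (n + 1) n.lt_succ_self⟩).elim
  obtain ⟨g₂, h₂ | h₂⟩ := exists_increasing_or_nonincreasing_subseq (· > ·) (c ∘ g₁)
  · exact ((wellFounded_iff_isEmpty_descending_chain.1 (wellFounded_lt (α := P))).false
      ⟨fun n => c (g₁ (g₂ n)), fun n => h₂ n (n + 1) n.lt_succ_self⟩).elim
  obtain ⟨g₃, h₃⟩ := exists_increasing_or_nonincreasing_subseq (· = ·) (c ∘ g₁ ∘ g₂)
  refine ⟨g₁ ∘ g₂ ∘ g₃, g₁.strictMono.comp (g₂.strictMono.comp g₃.strictMono),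
    h₃.imp (fun h₃ n => ?_) fun h₃ => ?_⟩
  · rcases n.eq_zero_or_pos with rfl | hn
    · rfl
    · exact (h₃ 0 n hn).symm
  · have hlt (m n : ℕ) (hmn : m < n) : ¬ c (g₁ (g₂ (g₃ m))) < c (g₁ (g₂ (g₃ n))) :=
      h₁ _ _ (g₂.strictMono (g₃.strictMono hmn))
    have hgt (m n : ℕ) (hmn : m < n) : ¬ c (g₁ (g₂ (g₃ n))) < c (g₁ (g₂ (g₃ m))) :=
      h₂ _ _ (g₃.strictMono hmn)
    intro m n hmn hle
    rcases lt_or_gt_of_ne hmn with h | h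
    · exact hlt m n h (lt_of_le_of_ne hle (h₃ m n h))
    · exact hgt n m h (lt_of_le_of_ne hle (Ne.symm (h₃ n m h)))

variable {X : Type u} [Semigroup X]

/-- `x` is invertible modulo `e` within the ideal center. -/
def InvMod (e : Idem (idealCenter X)) (x : X) : Prop := ∃ y ∈ idealCenter X, x * y = e.1

theorem invMod_mul (e : Idem (idealCenter X)) (x y : X) :
    InvMod e (x * y) ↔ InvMod e x ∧ InvMod e y := by
  constructor
  · rintro ⟨w, hw, h⟩
    have hyw : y * w ∈ idealCenter X := by
      rw [← mul_comm_of_mem_idealCenter hw]; exact mul_mem_idealCenter hw y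
    refine ⟨⟨y * w, hyw, by rw [← mul_assoc, h]⟩, w * x, mul_mem_idealCenter hw x, ?_⟩
    rw [← mul_assoc, mul_comm_of_mem_idealCenter hyw, ← mul_assoc, h]
  · rintro ⟨⟨v, hv, hxv⟩, w, hw, hyw⟩
    refine ⟨w * v, mul_mem hw hv, ?_⟩
    rw [mul_assoc, ← mul_assoc y, hyw, mul_comm_of_mem_idealCenter e.1.2, ← mul_assoc, hxv]
    exact congrArg Subtype.val e.2

theorem invMod_idem (e f : Idem (idealCenter X)) : InvMod e (f.1 : X) ↔ e ≤ f := by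
  constructor
  · rintro ⟨y, hy, h⟩
    refine Subtype.ext ?_
    have hf : (f.1 : X) * f.1 = f.1 := congrArg Subtype.val f.2
    change (e.1 : X) * f.1 = e.1
    rw [mul_comm_of_mem_idealCenter e.1.2, ← h, ← mul_assoc, hf]
  · intro h
    refine ⟨e.1, e.1.2, ?_⟩
    rw [← mul_comm_of_mem_idealCenter e.1.2]
    exact congrArg Subtype.val h

theorem InvMod.mono {e f : Idem (idealCenter X)} (h : e ≤ f) {x : X} (hx : InvMod f x) :
    InvMod e x := by
  obtain ⟨y, hy, hxy⟩ := hx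
  refine ⟨y * e.1, mul_mem hy e.1.2, ?_⟩
  rw [← mul_assoc, hxy, ← mul_comm_of_mem_idealCenter e.1.2]
  exact congrArg Subtype.val h

theorem AbsolutelyTzSClosed.wellFoundedGT (hX : AbsolutelyTzSClosed X) :
    WellFoundedGT (Idem (idealCenter X)) := by
  refine ⟨wellFounded_iff_isEmpty_descending_chain.2 ⟨fun ⟨c, hc⟩ => ?_⟩⟩
  have hmono : StrictMono c := strictMono_nat_of_lt_succ hc
  obtain ⟨x, hx⟩ := hX.exists_iff_of_eventually
    (fun i : Option ℕ => i.elim (fun x => ∀ n, InvMod (c n) x) fun n => InvMod (c n))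
    (fun i x y => by cases i <;> simp [invMod_mul, forall_and]) atTop (fun a => (c a).1.1)
    (fun i => i.elim False fun _ => True) (fun i => by
      cases i with
      | none =>
        refine Eventually.of_forall fun a => ?_
        simp only [Option.elim, iff_false, invMod_idem, not_forall]
        exact ⟨a + 1, (hmono a.lt_succ_self).not_ge⟩
      | some n =>
        refine (eventually_ge_atTop n).mono fun a ha => ?_
        simpa only [Option.elim, iff_true, invMod_idem] using hmono.monotone ha)
  exact (hx none).1 fun n => (hx (some n)).2 trivial

theorem AbsolutelyTzSClosed.wellFoundedLT (hX : AbsolutelyTzSClosed X) :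
    WellFoundedLT (Idem (idealCenter X)) := by
  refine ⟨wellFounded_iff_isEmpty_descending_chain.2 ⟨fun ⟨c, hc⟩ => ?_⟩⟩
  have hanti : StrictAnti c := strictAnti_nat_of_succ_lt hc
  obtain ⟨x, hx⟩ := hX.exists_iff_of_eventually
    (fun i : Option ℕ => i.elim (fun x => ∃ n, InvMod (c n) x) fun n => InvMod (c n))
    (fun i x y => by
      cases i with
      | none =>
        simp only [Option.elim, invMod_mul]
        refine ⟨fun ⟨n, h⟩ => ⟨⟨n, h.1⟩, n, h.2⟩, fun ⟨⟨m, h⟩, n, h'⟩ => ⟨max m n, ?_, ?_⟩⟩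
        · exact h.mono (hanti.antitone (le_max_left m n))
        · exact h'.mono (hanti.antitone (le_max_right m n))
      | some n => simp [invMod_mul]) atTop (fun a => (c a).1.1)
    (fun i => i.elim True fun _ => False) (fun i => by
      cases i with
      | none =>
        refine Eventually.of_forall fun a => ?_
        simp only [Option.elim, iff_true, invMod_idem]
        exact ⟨a, le_rfl⟩
      | some n =>
        refine (eventually_gt_atTop n).mono fun a ha => ?_
        simpa only [Option.elim, iff_false, invMod_idem] using (hanti ha).not_ge)
  obtain ⟨n, hn⟩ := (hx none).2 trivial
  exact (hx (some n)).1 hn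

end Idempotents

section Characters

theorem Submonoid.countable_closure {M : Type*} [Monoid M] {s : Set M} (hs : s.Countable) :
    Countable (Submonoid.closure s) := by
  have : Countable s := hs
  refine (Set.Countable.mono (fun x hx => ?_)
    (countable_range fun l : List s => (l.map Subtype.val).prod)).to_subtype
  obtain ⟨l, hl, rfl⟩ := Submonoid.exists_list_of_mem_closure hx
  lift l to List s using hl
  exact ⟨l, rfl⟩

variable {X : Type u} [Semigroup X]

theorem AbsolutelyTzSClosed.mem_range_of_countable (hX : AbsolutelyTzSClosed X) {M : Type}
    [Monoid M] [MetricSpace M] [ContinuousMul M] (h : X →ₙ* M) (hh : (range h).Countable) {y : M}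
    (hy : y ∈ closure (range h)) : y ∈ range h := by
  let K := Submonoid.closure (insert y (range h))
  have : Countable K := Submonoid.countable_closure (hh.insert y)
  let h' : X →ₙ* ULift.{u} K :=
    { toFun := fun x => ⟨h x, Submonoid.subset_closure (mem_insert_of_mem _ (mem_range_self x))⟩
      map_mul' := fun x y => by
        ext
        exact map_mul h x y }
  have hind : IsInducing fun k : ULift.{u} K => (k.down : M) :=
    IsInducing.subtypeVal.comp Homeomorph.ulift.isInducing
  have hc := hX _ (hasClopenBasis_of_countable _) h'
  have hmem : (⟨y, Submonoid.subset_closure (mem_insert _ _)⟩ : ULift.{u} K) ∈ range h' := by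
    rw [← hc.closure_eq, hind.closure_eq_preimage_closure_image, mem_preimage, ← range_comp]
    exact hy
  obtain ⟨x, hx⟩ := hmem
  exact ⟨x, congrArg (fun k : ULift.{u} K => (k.down : M)) hx⟩

/-- The standard embedding of the rational circle into the complex numbers. -/
noncomputable def ratCircleHom : Multiplicative (AddCircle (1 : ℚ)) →* ℂ :=
  Circle.coeHom.comp (AddMonoidHom.toMultiplicativeLeft (QuotientAddGroup.lift
    (AddSubgroup.zmultiples (1 : ℚ))
    { toFun := fun q => Additive.ofMul (Circle.exp (2 * Real.pi * q))
      map_zero' := by simp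
      map_add' := fun p q => by
        rw [← ofMul_mul, ← Circle.exp_add]
        push_cast
        rw [mul_add] }
    (by
      intro q hq
      obtain ⟨k, rfl⟩ := AddSubgroup.mem_zmultiples_iff.1 hq
      have : Circle.exp (2 * Real.pi * ((k • (1 : ℚ) : ℚ) : ℝ)) = 1 := by
        rw [Circle.exp_eq_one]
        exact ⟨k, by simp [mul_comm]⟩
      exact congrArg Additive.ofMul this)))

theorem ratCircleHom_apply (q : ℚ) : ratCircleHom (Multiplicative.ofAdd (q : AddCircle (1 : ℚ))) =
    Circle.exp (2 * Real.pi * q) := rfl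

variable {G : Type u} [CommGroup G]

theorem AbsolutelyTzSClosed.exists_nsmul_character_eq_zero (hX : AbsolutelyTzSClosed X)
    (φ : X →ₙ* WithZero G) (hφ : ∀ g : G, ∃ x, φ x = g) (χ : Additive G →+ AddCircle (1 : ℚ)) :
    ∃ n : ℕ, 0 < n ∧ ∀ a, n • χ a = 0 := by
  let R : AddSubgroup ℝ :=
    (χ.range.comap (QuotientAddGroup.mk' _)).map (Rat.castHom ℝ).toAddMonoidHom
  have hR (q : ℚ) : (q : ℝ) ∈ R ↔ (q : AddCircle (1 : ℚ)) ∈ χ.range :=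
    AddSubgroup.mem_map_iff_mem (f := (Rat.castHom ℝ).toAddMonoidHom) Rat.cast_injective
  rcases R.dense_or_cyclic with hd | ⟨a, ha⟩
  · exfalso
    let θ : G →* ℂ := ratCircleHom.comp (AddMonoidHom.toMultiplicativeRight χ)
    let h : X →ₙ* ℂ := (WithZero.lift' θ).toMonoidHom.toMulHom.comp φ
    have hh0 {x : X} (hx : φ x = 0) : h x = 0 := (congrArg (WithZero.lift' θ) hx).trans (map_zero _)
    have hh1 {x : X} {g : G} (hx : φ x = g) : h x = θ g :=
      (congrArg (WithZero.lift' θ) hx).trans (WithZero.lift'_coe _ _)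
    have hθ (g : G) : ∃ q : ℚ, (q : AddCircle (1 : ℚ)) = χ (Additive.ofMul g) ∧
        θ g = Circle.exp (2 * Real.pi * q) := by
      obtain ⟨q, hq⟩ := QuotientAddGroup.mk_surjective (χ (Additive.ofMul g))
      refine ⟨q, hq, ?_⟩
      rw [← ratCircleHom_apply]
      exact congrArg (fun c => ratCircleHom (Multiplicative.ofAdd c)) hq.symm
    have hcount : (range h).Countable := by
      refine ((countable_range fun q : ℚ => (Circle.exp (2 * Real.pi * q) : ℂ)).insert 0).mono ?_
      rintro _ ⟨x, rfl⟩
      rcases eq_or_ne (φ x) 0 with h0 | h0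
      · exact Or.inl (hh0 h0)
      · obtain ⟨g, hg⟩ := WithZero.ne_zero_iff_exists.1 h0
        obtain ⟨q, -, hq⟩ := hθ g
        exact Or.inr ⟨q, by rw [hh1 hg.symm, hq]⟩
    have hcont : Continuous fun r : ℝ => (Circle.exp (2 * Real.pi * r) : ℂ) := by fun_prop
    obtain ⟨x, hx⟩ := hX.mem_range_of_countable h hcount
      (map_mem_closure hcont (hd (√2)) (t := range h) (by
        rintro _ ⟨q, hq, rfl⟩
        obtain ⟨g, hg⟩ := hq
        obtain ⟨x, hx⟩ := hφ g.toMul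
        refine ⟨x, ?_⟩
        refine (hh1 hx).trans (Eq.trans ?_ (ratCircleHom_apply q))
        exact congrArg (fun c => ratCircleHom (Multiplicative.ofAdd c)) hg))
    have h0 : φ x ≠ 0 := fun h0 => by
      rw [hh0 h0] at hx
      exact Circle.coe_ne_zero _ hx.symm
    obtain ⟨g, hg⟩ := WithZero.ne_zero_iff_exists.1 h0
    obtain ⟨q, -, hq⟩ := hθ g
    rw [hh1 hg.symm, hq, Circle.coe_inj, Circle.exp_eq_exp] at hx
    obtain ⟨m, hm⟩ := hx
    refine irrational_sqrt_two ⟨q - m, ?_⟩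
    have h2 : (q : ℝ) = √2 + m := by
      have hpi := Real.pi_pos
      refine mul_left_cancel₀ (mul_pos two_pos hpi).ne' ?_
      rw [hm]
      ring
    push_cast
    rw [h2]
    ring
  · have h1 : ((1 : ℚ) : ℝ) ∈ R := (hR 1).2 ⟨0, by
      rw [map_zero]
      exact (AddCircle.coe_period (1 : ℚ)).symm⟩
    rw [ha, AddSubgroup.mem_closure_singleton] at h1
    obtain ⟨k, hk⟩ := h1
    have hk0 : k ≠ 0 := by
      rintro rfl
      simp at hk
    refine ⟨k.natAbs, Int.natAbs_pos.2 hk0, fun b => ?_⟩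
    obtain ⟨q, hq⟩ := QuotientAddGroup.mk_surjective (χ b)
    have hqR := (hR q).2 ⟨b, hq.symm⟩
    rw [ha, AddSubgroup.mem_closure_singleton] at hqR
    obtain ⟨m, hm⟩ := hqR
    have hkq : k • q = (m : ℚ) := by
      have : ((k • q : ℚ) : ℝ) = (m : ℚ) := by
        rw [zsmul_eq_mul] at hk hm ⊢
        push_cast at hk ⊢
        rw [← hm]
        linear_combination (m : ℝ) * hk
      exact_mod_cast this
    have hz : k • χ b = 0 := by
      rw [← hq]
      change ((k • q : ℚ) : AddCircle (1 : ℚ)) = 0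
      rw [hkq, AddCircle.coe_eq_zero_iff]
      exact ⟨m, by simp⟩
    rcases Int.natAbs_eq k with h | h
    · rw [h, natCast_zsmul] at hz
      exact hz
    · rw [h, neg_zsmul, natCast_zsmul, neg_eq_zero] at hz
      exact hz

end Characters

section UnboundedCharacter

variable {A : Type*} [AddCommGroup A]

theorem exists_nsmul_closure_eq_zero (htors : ∀ a : A, ∃ n, 0 < n ∧ n • a = 0) (F : Finset A) :
    ∃ m, 0 < m ∧ ∀ a ∈ AddSubgroup.closure (F : Set A), m • a = 0 := by
  choose o ho ho' using htors
  refine ⟨∏ a ∈ F, o a, Finset.prod_pos fun a _ => ho a, fun a ha => ?_⟩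
  induction ha using AddSubgroup.closure_induction with
  | mem a ha =>
    obtain ⟨k, hk⟩ := Finset.dvd_prod_of_mem o ha
    rw [hk, mul_comm, mul_nsmul', ho', nsmul_zero]
  | zero => exact nsmul_zero _
  | add a b _ _ ha hb => rw [nsmul_add, ha, hb, add_zero]
  | neg a _ ha => rw [neg_nsmul, ha, neg_zero]

theorem exists_character_eqOn (htors : ∀ a : A, ∃ n, 0 < n ∧ n • a = 0)
    (hunb : ∀ n, 0 < n → ∃ a : A, n • a ≠ 0) (F : Finset A) (χ : A →+ AddCircle (1 : ℚ)) {n : ℕ}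
    (hn : 0 < n) : ∃ (b : A) (χ' : A →+ AddCircle (1 : ℚ)), (∀ a ∈ F, χ' a = χ a) ∧
      n • χ' b ≠ 0 := by
  obtain ⟨m, hm, hm'⟩ := exists_nsmul_closure_eq_zero htors F
  obtain ⟨b, hb⟩ := hunb (m * n) (Nat.mul_pos hm hn)
  by_cases hχ : n • χ b = 0
  swap
  · exact ⟨b, χ, fun _ _ => rfl, hχ⟩
  have hb' : ((n • b : A) : A ⧸ AddSubgroup.closure (F : Set A)) ≠ 0 := fun h => by
    rw [mul_nsmul'] at hb
    exact hb (hm' _ ((QuotientAddGroup.eq_zero_iff _).1 h))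
  obtain ⟨ψ, hψ⟩ := CharacterModule.exists_character_apply_ne_zero_of_ne_zero hb'
  refine ⟨b, χ + (ψ : _ →+ _).comp (QuotientAddGroup.mk' _), fun a ha => ?_, ?_⟩
  · have : (a : A ⧸ AddSubgroup.closure (F : Set A)) = 0 :=
      (QuotientAddGroup.eq_zero_iff _).2 (AddSubgroup.subset_closure ha)
    change χ a + ψ (a : A ⧸ AddSubgroup.closure (F : Set A)) = χ a
    rw [this, map_zero, add_zero]
  · change n • (χ b + ψ (b : A ⧸ AddSubgroup.closure (F : Set A))) ≠ 0
    rw [nsmul_add, hχ, zero_add, ← map_nsmul]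
    exact hψ

theorem exists_ultralimit_hom {B : Type*} [AddCommGroup B] (htors : ∀ a : A, ∃ n, 0 < n ∧ n • a = 0)
    (hB : ∀ n, 0 < n → {b : B | n • b = 0}.Finite) {α : Type*} (χ : α → A →+ B)
    (U : Ultrafilter α) : ∃ ψ : A →+ B, ∀ a, ∀ᶠ i in U, χ i a = ψ a := by
  have h (a : A) : ∃ b, ∀ᶠ i in U, χ i a = b := by
    obtain ⟨n, hn, hna⟩ := htors a
    have hU : ∀ᶠ i in U, ∃ b ∈ {b : B | n • b = 0}, χ i a = b :=
      Eventually.of_forall fun i => ⟨χ i a, by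
        change n • χ i a = 0
        rw [← map_nsmul, hna, map_zero], rfl⟩
    obtain ⟨b, -, hb⟩ := (Ultrafilter.eventually_exists_mem_iff (hB n hn)).1 hU
    exact ⟨b, hb⟩
  choose ψ hψ using h
  refine ⟨AddMonoidHom.mk' ψ fun a b => ?_, hψ⟩
  obtain ⟨i, h1, h2, h3⟩ := ((hψ a).and ((hψ b).and (hψ (a + b)))).exists
  rw [← h1, ← h2, ← h3, map_add]

theorem exists_unbounded_character (htors : ∀ a : A, ∃ n, 0 < n ∧ n • a = 0)
    (hunb : ∀ n, 0 < n → ∃ a : A, n • a ≠ 0) :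
    ∃ χ : A →+ AddCircle (1 : ℚ), ∀ n, 0 < n → ∃ a, n • χ a ≠ 0 := by
  classical
  choose! b χ' hχ' hb using fun (n : ℕ) (hn : 0 < n) (F : Finset A) χ =>
    exists_character_eqOn htors hunb F χ hn
  let step (n : ℕ) (p : Finset A × (A →+ AddCircle (1 : ℚ))) :
      Finset A × (A →+ AddCircle (1 : ℚ)) := (insert (b n.factorial p.1 p.2) p.1,
        χ' n.factorial p.1 p.2)
  let p (n : ℕ) : Finset A × (A →+ AddCircle (1 : ℚ)) := Nat.rec (∅, 0) step n
  have hp (n : ℕ) : p (n + 1) = step n (p n) := rfl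
  have hF : Monotone fun n => (p n).1 :=
    monotone_nat_of_le_succ fun n => by
      rw [hp]
      exact Finset.subset_insert _ _
  have hχ (m n : ℕ) (hmn : m ≤ n) : ∀ a ∈ (p m).1, (p n).2 a = (p m).2 a := by
    induction n, hmn using Nat.le_induction with
    | base => exact fun _ _ => rfl
    | succ n hmn ih => exact fun a ha => (hχ' _ n.factorial_pos _ _ a (hF hmn ha)).trans (ih a ha)
  obtain ⟨ψ, hψ⟩ := exists_ultralimit_hom htors (fun n hn => AddCircle.finite_torsion 1 hn)
    (fun n => (p n).2) (hyperfilter ℕ)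
  refine ⟨ψ, fun n hn => ?_⟩
  have hmem : b n.factorial (p n).1 (p n).2 ∈ (p (n + 1)).1 := Finset.mem_insert_self _ _
  refine ⟨b n.factorial (p n).1 (p n).2, fun h0 => hb _ n.factorial_pos (p n).1 (p n).2 ?_⟩
  have hev : ∀ᶠ i in (hyperfilter ℕ : Filter ℕ), n + 1 ≤ i :=
    Nat.hyperfilter_le_atTop (eventually_ge_atTop (n + 1))
  obtain ⟨i, hi, hi'⟩ := (hev.and (hψ (b n.factorial (p n).1 (p n).2))).exists
  obtain ⟨k, hk⟩ := Nat.dvd_factorial hn le_rfl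
  rw [hχ _ _ hi _ hmem] at hi'
  change n.factorial • (p (n + 1)).2 _ = 0
  rw [hi']
  generalize ψ (b n.factorial (p n).1 (p n).2) = c at h0
  rw [hk, mul_comm, mul_nsmul', h0, nsmul_zero]

end UnboundedCharacter

section FiniteGroup

/-- An abelian group of finite exponent with finite quotients modulo all primes is finite. -/
theorem finite_of_finite_quotients {A : Type*} [AddCommGroup A] {N : ℕ} (hN : N ≠ 0)
    (hA : ∀ a : A, N • a = 0)
    (hp : ∀ p : ℕ, p.Prime → ∃ F : Set A, F.Finite ∧ ∀ a, ∃ f ∈ F, ∃ b, a = f + p • b) :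
    Finite A := by
  have h (n : ℕ) : n ≠ 0 → ∃ F : Set A, F.Finite ∧ ∀ a, ∃ f ∈ F, ∃ b, a = f + n • b := by
    induction n using induction_on_primes with
    | zero => exact fun h => absurd rfl h
    | one => exact fun _ => ⟨{0}, finite_singleton 0, fun a => ⟨0, rfl, a, by simp⟩⟩
    | prime_mul p n hprime ih =>
      intro hpn
      obtain ⟨F, hF, hF'⟩ := ih (right_ne_zero_of_mul hpn)
      obtain ⟨E, hE, hE'⟩ := hp p hprime
      refine ⟨image2 (fun f e => f + n • e) F E, hF.image2 _ hE, fun a => ?_⟩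
      obtain ⟨f, hf, b, rfl⟩ := hF' a
      obtain ⟨e, he, c, rfl⟩ := hE' b
      exact ⟨_, mem_image2_of_mem hf he, c, by rw [nsmul_add, mul_comm, mul_nsmul', add_assoc]⟩
  obtain ⟨F, hF, hF'⟩ := h N hN
  refine finite_univ_iff.1 (hF.subset fun a _ => ?_)
  obtain ⟨f, hf, b, rfl⟩ := hF' a
  rwa [hA, add_zero]

/-- The coordinate functionals of an infinite vector space over a finite field. -/
theorem exists_coordinates (K : Type*) [Field K] [Finite K] (Q : Type u) [AddCommGroup Q]
    [Module K Q] [Infinite Q] :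
    ∃ (I : Type u) (_ : DecidableEq I) (μ : I → Q →+ K) (c : I → Q), Nonempty I ∧
      (∀ i j, μ i (c j) = if j = i then 1 else 0) ∧ ∀ q, ∃ i, μ i q = 0 := by
  classical
  let b := Module.Basis.ofVectorSpace K Q
  have hinf : Infinite (Module.Basis.ofVectorSpaceIndex K Q) := by
    by_contra hfin
    rw [not_infinite_iff_finite] at hfin
    have := Module.Finite.of_basis b
    have := Module.finite_of_finite K (M := Q)
    exact not_finite Q
  refine ⟨Module.Basis.ofVectorSpaceIndex K Q, inferInstance,
    fun i => (b.coord i).toAddMonoidHom, b, inferInstance, fun i j => ?_, fun q => ?_⟩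
  · change b.coord i (b j) = _
    rw [b.coord_apply, b.repr_self, Finsupp.single_apply]
  · obtain ⟨i, hi⟩ := Infinite.exists_notMem_finset (b.repr q).support
    exact ⟨i, Finsupp.notMem_support_iff.1 hi⟩

variable {X : Type u} [Semigroup X] {G : Type u} [CommGroup G]

theorem AbsolutelyTzSClosed.exists_finite_quotient (hX : AbsolutelyTzSClosed X)
    (φ : X →ₙ* WithZero G) (hφ : ∀ g : G, ∃ x, φ x = g) (p : ℕ) (hp : p.Prime) :
    ∃ F : Set (Additive G), F.Finite ∧ ∀ a, ∃ f ∈ F, ∃ b, a = f + p • b := by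
  let R : AddSubgroup (Additive G) := (nsmulAddMonoidHom p).range
  let Q := Additive G ⧸ R
  have hpQ (q : Q) : p • q = 0 := by
    obtain ⟨a, rfl⟩ := QuotientAddGroup.mk_surjective q
    exact (QuotientAddGroup.eq_zero_iff _).2 ⟨a, rfl⟩
  have : Finite Q := by
    by_contra hinf
    rw [not_finite_iff_infinite] at hinf
    have : Fact p.Prime := ⟨hp⟩
    obtain ⟨I, _, μ', c', _, hμc', hμ'⟩ :=
      @exists_coordinates (ZMod p) _ _ Q _ (AddCommGroup.zmodModule hpQ) hinf
    let μ (i : I) : Additive G →+ ZMod p := (μ' i).comp (QuotientAddGroup.mk' R)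
    choose c hc using fun i => QuotientAddGroup.mk'_surjective R (c' i)
    have hμc (i j : I) : μ i (c j) = if j = i then 1 else 0 := by
      rw [← hμc', ← hc]
      rfl
    obtain ⟨x, g, -, hg⟩ := hX.exists_mem_of_eventually φ
      (fun i : I => AddSubgroup.toSubgroup' (μ i).ker) atTop
      (fun s : Finset I => (∑ j ∈ s, c j).toMul) (fun s => hφ _) (fun i => (c i).toMul)
      (fun i => (eventually_ge_atTop {i}).mono fun s hs => by
        change μ i (-(∑ j ∈ s, c j) + c i) = 0
        have his : i ∈ s := hs (Finset.mem_singleton_self i)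
        simp [map_sum, hμc, his])
    obtain ⟨i, hi⟩ := hμ' (QuotientAddGroup.mk' R (Additive.ofMul g))
    have h1 : μ i (-(Additive.ofMul g) + c i) = 0 := hg i
    have h2 : μ i (Additive.ofMul g) = 0 := hi
    rw [map_add, map_neg, h2, hμc] at h1
    simp at h1
  refine ⟨range (Quotient.out : Q → Additive G), finite_range _, fun a => ?_⟩
  refine ⟨(a : Q).out, mem_range_self _, ?_⟩
  obtain ⟨d, hd⟩ : -(a : Q).out + a ∈ R := QuotientAddGroup.eq.1 (QuotientAddGroup.out_eq' _)
  refine ⟨d, ?_⟩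
  change p • d = _ at hd
  rw [hd, add_neg_cancel_left]

theorem AbsolutelyTzSClosed.finite_of_surjective (hX : AbsolutelyTzSClosed X)
    (φ : X →ₙ* WithZero G) (hφ : ∀ g : G, ∃ x, φ x = g) : Finite G := by
  have htors (a : Additive G) : ∃ n, 0 < n ∧ n • a = 0 := by
    obtain ⟨x, hx⟩ := hφ a.toMul
    obtain ⟨n, hn, h⟩ := isOfFinOrder_iff_pow_eq_one.1 (hX.isOfFinOrder φ hx)
    exact ⟨n, hn, h⟩
  by_cases h : ∃ n, 0 < n ∧ ∀ a : Additive G, n • a = 0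
  · obtain ⟨n, hn, hna⟩ := h
    have := finite_of_finite_quotients hn.ne' hna (hX.exists_finite_quotient φ hφ)
    exact Finite.of_equiv _ Additive.toMul
  · push Not at h
    obtain ⟨χ, hχ⟩ := exists_unbounded_character htors h
    obtain ⟨n, hn, hn'⟩ := hX.exists_nsmul_character_eq_zero φ hφ χ
    obtain ⟨a, ha⟩ := hχ n hn
    exact absurd (hn' a) ha

end FiniteGroup

section NhdsTopology

variable {Y : Type*} {F : Y → Filter Y}

theorem nhds_mkOfNhds_pure_sup (h : ∀ a, ∀ᶠ b in F a, F b = ⊥) (a : Y) :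
    @nhds Y (TopologicalSpace.mkOfNhds fun a => pure a ⊔ F a) a = pure a ⊔ F a := by
  refine TopologicalSpace.nhds_mkOfNhds _ a (fun _ => le_sup_left) fun a s hs => ?_
  refine eventually_sup.2 ⟨hs, ?_⟩
  filter_upwards [h a, hs.2] with b hb hbs
  rw [hb, sup_bot_eq]
  exact hbs

theorem t1Space_of_nhds_eq_pure_sup [TopologicalSpace Y] (hF : ∀ a : Y, 𝓝 a = pure a ⊔ F a)
    (h : ∀ a b, {a}ᶜ ∈ F b) : T1Space Y := by
  refine ⟨fun a => ⟨isOpen_iff_mem_nhds.2 fun b hb => ?_⟩⟩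
  rw [hF]
  exact ⟨hb, h a b⟩

theorem hasClopenBasis_of_nhds_eq_pure_sup [TopologicalSpace Y]
    (hF : ∀ a : Y, 𝓝 a = pure a ⊔ F a) (h₁ : ∀ a, ∀ᶠ b in F a, F b = ⊥)
    (h₂ : ∀ a b, {a}ᶜ ∈ F b) (h₃ : ∀ a, ∃ D ∈ F a, ∀ b, b ≠ a → Dᶜ ∈ F b) :
    HasClopenBasis Y := by
  refine hasClopenBasis_of_nhds fun a s hs => ?_
  rw [hF] at hs
  obtain ⟨D, hD, hD'⟩ := h₃ a
  refine ⟨insert a (s ∩ D ∩ {b | F b = ⊥}), ⟨⟨isOpen_iff_mem_nhds.2 fun b hb => ?_⟩,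
    isOpen_iff_mem_nhds.2 fun b hb => ?_⟩, mem_insert _ _,
    insert_subset hs.1 fun b hb => hb.1.1⟩
  · rw [mem_compl_iff, mem_insert_iff, not_or] at hb
    rw [hF]
    refine ⟨fun h => h.elim hb.1 hb.2, ?_⟩
    filter_upwards [hD' b hb.1, h₂ a b] with c hc hca
    rintro (h | h)
    exacts [hca h, hc h.1.2]
  · rw [hF]
    refine ⟨hb, ?_⟩
    rcases hb with rfl | hb
    · filter_upwards [hs.2, hD, h₁ b] with c h1 h2 h3 using Or.inr ⟨⟨h1, h2⟩, h3⟩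
    · rw [show F b = ⊥ from hb.2]
      exact mem_bot

theorem continuousMul_of_nhds_eq_pure_sup [TopologicalSpace Y] [CommSemigroup Y]
    (hF : ∀ a : Y, 𝓝 a = pure a ⊔ F a) (h₁ : ∀ a b, Tendsto (a * ·) (F b) (𝓝 (a * b)))
    (h₂ : ∀ a b, Tendsto (fun p : Y × Y => p.1 * p.2) (F a ×ˢ F b) (𝓝 (a * b))) :
    ContinuousMul Y := by
  refine ⟨continuous_iff_continuousAt.2 fun ⟨a, b⟩ => ?_⟩
  rw [ContinuousAt, nhds_prod_eq, hF a, hF b, sup_prod, prod_sup, prod_sup]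
  refine ((Tendsto.sup ?_ ?_).sup (Tendsto.sup ?_ (h₂ a b)))
  · rw [prod_pure_pure, tendsto_pure_left]
    exact fun s hs => mem_of_mem_nhds hs
  · rw [pure_prod, tendsto_map'_iff]
    exact h₁ a b
  · rw [prod_pure, tendsto_map'_iff, mul_comm a b]
    exact (h₁ b a).congr fun c => mul_comm b c

end NhdsTopology

/-- A commutative semigroup with zero containing cyclic pieces `{hump n k : k ≥ 1}` that annihilate
each other, such that every element acts trivially on almost all pieces. -/
structure HumpSystem (Q : Type u) [CommSemigroup Q] where
  zero : Q
  hump : ℕ → ℕ → Q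
  mul_zero (p : Q) : p * zero = zero
  hump_ne_zero (n k : ℕ) : hump n k ≠ zero
  hump_mul_self (n k l : ℕ) : hump n k * hump n l = hump n (k + l)
  hump_mul_ne (n m k l : ℕ) : n ≠ m → hump n k * hump m l = zero
  eq_of_hump_eq (n m k l : ℕ) : hump n k = hump m l → n = m
  hump_one_ne (n k : ℕ) : 2 ≤ k → k ≤ n → hump n 1 ≠ hump n k
  eventually_mul (p : Q) :
    ∀ᶠ n in atTop, (∀ k, p * hump n k = hump n k) ∨ ∀ k, p * hump n k = zero

namespace HumpSystem

variable {Q : Type u} [CommSemigroup Q] (H : HumpSystem Q)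

/-- The semigroup `Q` with a limit point of the sequence `hump n 1` adjoined. -/
inductive Ext (_ : HumpSystem Q) : Type u
  | limit
  | of (q : Q)

/-- The elements that act as identities on the humps along a nonprincipal ultrafilter. -/
def Unital (p : Q) : Prop := ∀ᶠ n in (hyperfilter ℕ : Filter ℕ), ∀ k, p * H.hump n k = H.hump n k

theorem eventually_of_not_unital {p : Q} (hp : ¬ H.Unital p) :
    ∀ᶠ n in (hyperfilter ℕ : Filter ℕ), ∀ k, p * H.hump n k = H.zero := by
  filter_upwards [Ultrafilter.eventually_not.2 hp, Nat.hyperfilter_le_atTop (H.eventually_mul p)]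
    with n h1 h2 using h2.resolve_left h1

theorem unital_mul (p q : Q) : H.Unital (p * q) ↔ H.Unital p ∧ H.Unital q := by
  refine ⟨fun h => ?_, fun h => ?_⟩
  · by_contra hpq
    have : ∀ᶠ n in (hyperfilter ℕ : Filter ℕ), p * q * H.hump n 1 = H.zero := by
      rcases not_and_or.1 hpq with hp | hq
      · filter_upwards [H.eventually_of_not_unital hp] with n hn
        rw [mul_comm p, mul_assoc, hn, H.mul_zero]
      · filter_upwards [H.eventually_of_not_unital hq] with n hn
        rw [mul_assoc, hn, H.mul_zero]
    obtain ⟨n, h1, h2⟩ := (this.and h).exists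
    exact H.hump_ne_zero n 1 ((h2 1).symm.trans h1)
  · filter_upwards [h.1, h.2] with n h1 h2 k
    rw [mul_assoc, h2, h1]

theorem not_unital_zero : ¬ H.Unital H.zero := fun h => by
  obtain ⟨n, hn⟩ := h.exists
  have := hn 1
  rw [mul_comm, H.mul_zero] at this
  exact H.hump_ne_zero n 1 this.symm

theorem not_unital_hump (n k : ℕ) : ¬ H.Unital (H.hump n k) := fun h => by
  have hev : ∀ᶠ m in (hyperfilter ℕ : Filter ℕ), n < m :=
    Nat.hyperfilter_le_atTop (eventually_gt_atTop n)
  obtain ⟨m, hm, hnm⟩ := (h.and hev).exists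
  exact H.hump_ne_zero m 1 ((hm 1).symm.trans (H.hump_mul_ne n m k 1 hnm.ne))

open Classical in
noncomputable instance : Mul H.Ext where
  mul
    | .of p, Ext.of q => Ext.of (p * q)
    | .of p, Ext.limit => if H.Unital p then Ext.limit else Ext.of H.zero
    | .limit, Ext.of q => if H.Unital q then Ext.limit else Ext.of H.zero
    | .limit, Ext.limit => Ext.of H.zero

theorem of_mul_of (p q : Q) : (Ext.of p * Ext.of q : H.Ext) = Ext.of (p * q) := rfl

theorem limit_mul_limit : (Ext.limit * Ext.limit : H.Ext) = Ext.of H.zero := rfl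

theorem of_mul_limit_of_unital {p : Q} (hp : H.Unital p) :
    (Ext.of p * Ext.limit : H.Ext) = Ext.limit :=
  if_pos hp

theorem of_mul_limit {p : Q} (hp : ¬ H.Unital p) : (Ext.of p * Ext.limit : H.Ext) = Ext.of H.zero :=
  if_neg hp

protected theorem mul_comm' : ∀ a b : H.Ext, a * b = b * a
  | .limit, Ext.limit => rfl
  | .limit, Ext.of _ => rfl
  | .of _, Ext.limit => rfl
  | .of p, Ext.of q => congrArg Ext.of (mul_comm p q)

theorem of_zero_mul (a : H.Ext) : (Ext.of H.zero * a : H.Ext) = Ext.of H.zero := by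
  cases a with
  | limit => exact H.of_mul_limit H.not_unital_zero
  | of p => rw [of_mul_of, mul_comm, H.mul_zero]

protected theorem mul_assoc' (a b c : H.Ext) : a * b * c = a * (b * c) := by
  have key (p : Q) (b c : H.Ext) : Ext.of p * b * c = Ext.of p * (b * c) := by
    by_cases hp : H.Unital p
    · rcases b with _ | q <;> rcases c with _ | r
      · rw [of_mul_limit_of_unital H hp, limit_mul_limit, of_mul_of, H.mul_zero]
      · rw [of_mul_limit_of_unital H hp, H.mul_comm' Ext.limit]
        by_cases hr : H.Unital r
        · rw [of_mul_limit_of_unital H hr, of_mul_limit_of_unital H hp]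
        · rw [of_mul_limit H hr, of_mul_of, H.mul_zero]
      · rw [of_mul_of]
        by_cases hq : H.Unital q
        · rw [of_mul_limit_of_unital H hq, of_mul_limit_of_unital H hp,
            of_mul_limit_of_unital H ((H.unital_mul p q).2 ⟨hp, hq⟩)]
        · rw [of_mul_limit H hq, of_mul_of, H.mul_zero,
            of_mul_limit H fun h => hq ((H.unital_mul p q).1 h).2]
      · exact congrArg Ext.of (mul_assoc p q r)
    · rcases b with _ | q <;> rcases c with _ | r
      · rw [of_mul_limit H hp, limit_mul_limit, of_mul_of, H.mul_zero, of_zero_mul]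
      · rw [of_mul_limit H hp, of_zero_mul, H.mul_comm' Ext.limit]
        by_cases hr : H.Unital r
        · rw [of_mul_limit_of_unital H hr, of_mul_limit H hp]
        · rw [of_mul_limit H hr, of_mul_of, H.mul_zero]
      · rw [of_mul_of, of_mul_limit H fun h => hp ((H.unital_mul p q).1 h).1]
        by_cases hq : H.Unital q
        · rw [of_mul_limit_of_unital H hq, of_mul_limit H hp]
        · rw [of_mul_limit H hq, of_mul_of, H.mul_zero]
      · exact congrArg Ext.of (mul_assoc p q r)
  rcases a with _ | p
  · rcases c with _ | r
    · rw [H.mul_comm' _ Ext.limit, H.mul_comm' Ext.limit b]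
    · rw [H.mul_comm' _ (Ext.of r), H.mul_comm' Ext.limit b, ← key, ← H.mul_comm' Ext.limit,
        H.mul_comm' b]
  · exact key p b c

noncomputable instance : CommSemigroup H.Ext where
  mul_assoc := H.mul_assoc'
  mul_comm := H.mul_comm'

/-- The filter on `H.Ext` of sets containing all humps `hump n k` for which `n` is large
compared with `k`. -/
def zeroFilter : Filter H.Ext where
  sets := {s | ∃ j, ∀ n k, 2 ≤ k → j * k ≤ n → Ext.of (H.hump n k) ∈ s}
  univ_sets := ⟨0, fun _ _ _ _ => mem_univ _⟩
  sets_of_superset := fun ⟨j, hj⟩ h => ⟨j, fun n k h1 h2 => h (hj n k h1 h2)⟩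
  inter_sets := fun ⟨i, hi⟩ ⟨j, hj⟩ => ⟨i + j, fun n k h1 h2 =>
    ⟨hi n k h1 ((Nat.mul_le_mul_right k (Nat.le_add_right i j)).trans h2),
      hj n k h1 ((Nat.mul_le_mul_right k (Nat.le_add_left j i)).trans h2)⟩⟩

open Classical in
/-- The punctured neighbourhood filters of the topology on `H.Ext`. -/
noncomputable def punctured : H.Ext → Filter H.Ext
  | .limit => map (fun n => Ext.of (H.hump n 1)) (hyperfilter ℕ : Filter ℕ)
  | .of p => if p = H.zero then H.zeroFilter else ⊥

theorem punctured_limit :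
    H.punctured Ext.limit = map (fun n => Ext.of (H.hump n 1)) (hyperfilter ℕ : Filter ℕ) := rfl

theorem punctured_zero : H.punctured (Ext.of H.zero) = H.zeroFilter := if_pos rfl

theorem punctured_of {p : Q} (hp : p ≠ H.zero) : H.punctured (Ext.of p) = ⊥ := if_neg hp

theorem eventually_limit {P : H.Ext → Prop} : (∀ᶠ b in H.punctured Ext.limit, P b) ↔
    ∀ᶠ n in (hyperfilter ℕ : Filter ℕ), P (Ext.of (H.hump n 1)) := Iff.rfl

theorem eventually_hyperfilter_gt (m : ℕ) : ∀ᶠ n in (hyperfilter ℕ : Filter ℕ), m < n :=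
  Nat.hyperfilter_le_atTop (eventually_gt_atTop m)

/-- Case analysis on points of `H.Ext` according to their punctured neighbourhoods. -/
theorem forall_ext {P : H.Ext → Prop} (h₁ : P Ext.limit) (h₂ : P (Ext.of H.zero))
    (h₃ : ∀ p, p ≠ H.zero → P (Ext.of p)) : ∀ a, P a
  | .limit => h₁
  | .of p => by
    by_cases hp : p = H.zero
    · rw [hp]; exact h₂
    · exact h₃ p hp

theorem eventually_punctured_eq_bot (a : H.Ext) : ∀ᶠ b in H.punctured a, H.punctured b = ⊥ := by
  induction a using H.forall_ext with
  | h₁ => exact H.eventually_limit.2 (.of_forall fun n => H.punctured_of (H.hump_ne_zero n 1))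
  | h₂ =>
    rw [punctured_zero]
    exact ⟨0, fun n k _ _ => H.punctured_of (H.hump_ne_zero n k)⟩
  | h₃ p hp => rw [H.punctured_of hp]; exact eventually_bot

theorem compl_singleton_mem_punctured (a b : H.Ext) : {a}ᶜ ∈ H.punctured b := by
  obtain ⟨N, hN⟩ : ∃ N, ∀ n k, N < n → Ext.of (H.hump n k) ≠ a := by
    by_cases h : ∃ n k, Ext.of (H.hump n k) = a
    · obtain ⟨n, k, rfl⟩ := h
      exact ⟨n, fun m l hm h => hm.ne' (H.eq_of_hump_eq m n l k (Ext.of.inj h))⟩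
    · push Not at h
      exact ⟨0, fun n k _ => h n k⟩
  induction b using H.forall_ext with
  | h₁ =>
    refine H.eventually_limit.2 ?_
    filter_upwards [eventually_hyperfilter_gt N] with n hn using hN n 1 hn
  | h₂ =>
    rw [punctured_zero]
    exact ⟨N + 1, fun n k hk hn => hN n k (by nlinarith)⟩
  | h₃ p hp => rw [H.punctured_of hp]; exact mem_bot

theorem exists_separating (a : H.Ext) :
    ∃ D ∈ H.punctured a, ∀ b, b ≠ a → Dᶜ ∈ H.punctured b := by
  induction a using H.forall_ext with
  | h₁ =>
    refine ⟨Set.range fun n => Ext.of (H.hump n 1),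
      H.eventually_limit.2 (.of_forall fun n => mem_range_self n), fun b hb => ?_⟩
    induction b using H.forall_ext with
    | h₁ => exact (hb rfl).elim
    | h₂ =>
      rw [punctured_zero]
      refine ⟨1, fun n k hk hn => ?_⟩
      rintro ⟨m, hm⟩
      have hm := Ext.of.inj hm
      obtain rfl := H.eq_of_hump_eq _ _ _ _ hm
      exact H.hump_one_ne m k hk (by omega) hm
    | h₃ p hp => rw [H.punctured_of hp]; exact mem_bot
  | h₂ =>
    refine ⟨{x | ∃ n k, 2 ≤ k ∧ k ≤ n ∧ Ext.of (H.hump n k) = x}, ?_, fun b hb => ?_⟩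
    · rw [punctured_zero]
      exact ⟨1, fun n k h1 h2 => ⟨n, k, h1, by omega, rfl⟩⟩
    induction b using H.forall_ext with
    | h₁ =>
      refine H.eventually_limit.2 (.of_forall ?_)
      rintro n ⟨m, k, h1, h2, h3⟩
      have h3 := Ext.of.inj h3
      obtain rfl := H.eq_of_hump_eq _ _ _ _ h3
      exact H.hump_one_ne m k h1 h2 h3.symm
    | h₂ => exact (hb rfl).elim
    | h₃ p hp => rw [H.punctured_of hp]; exact mem_bot
  | h₃ p hp =>
    refine ⟨∅, by rw [H.punctured_of hp]; exact mem_bot, fun b _ => ?_⟩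
    rw [compl_empty]
    exact univ_mem

/-- The topology on `H.Ext` with the given punctured neighbourhoods. -/
noncomputable instance : TopologicalSpace H.Ext :=
  TopologicalSpace.mkOfNhds fun a => pure a ⊔ H.punctured a

theorem nhds_eq (a : H.Ext) : 𝓝 a = pure a ⊔ H.punctured a :=
  nhds_mkOfNhds_pure_sup H.eventually_punctured_eq_bot a

instance : T1Space H.Ext :=
  t1Space_of_nhds_eq_pure_sup H.nhds_eq H.compl_singleton_mem_punctured

theorem hasClopenBasis : HasClopenBasis H.Ext :=
  hasClopenBasis_of_nhds_eq_pure_sup H.nhds_eq H.eventually_punctured_eq_bot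
    H.compl_singleton_mem_punctured H.exists_separating

theorem tendsto_mul_left (a b : H.Ext) : Tendsto (a * ·) (H.punctured b) (𝓝 (a * b)) := by
  induction b using H.forall_ext with
  | h₁ =>
    cases a with
    | limit =>
      refine tendsto_nhds_of_eventually_eq (H.eventually_limit.2 (.of_forall fun n => ?_))
      rw [mul_comm, H.of_mul_limit (H.not_unital_hump n 1), limit_mul_limit]
    | of p =>
      by_cases hp : H.Unital p
      · rw [H.of_mul_limit_of_unital hp, H.nhds_eq]
        refine Tendsto.mono_right ?_ le_sup_right
        rw [punctured_limit, tendsto_map'_iff]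
        refine Tendsto.congr' ?_ tendsto_map
        filter_upwards [hp] with n hn
        exact congrArg Ext.of (hn 1).symm
      · rw [H.of_mul_limit hp]
        refine tendsto_nhds_of_eventually_eq (H.eventually_limit.2 ?_)
        filter_upwards [H.eventually_of_not_unital hp] with n hn
        exact congrArg Ext.of (hn 1)
  | h₂ =>
    rw [punctured_zero, mul_comm a, of_zero_mul, H.nhds_eq, punctured_zero]
    intro s hs
    obtain ⟨hs0, j, hj⟩ := hs
    cases a with
    | limit =>
      refine ⟨0, fun n k _ _ => ?_⟩
      change Ext.limit * Ext.of (H.hump n k) ∈ s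
      rw [mul_comm, H.of_mul_limit (H.not_unital_hump n k)]
      exact hs0
    | of p =>
      obtain ⟨N, hN⟩ := eventually_atTop.1 (H.eventually_mul p)
      refine ⟨j + N, fun n k hk hn => ?_⟩
      change Ext.of (p * H.hump n k) ∈ s
      rcases hN n (by nlinarith) with h | h
      · rw [h]
        exact hj n k hk (by nlinarith)
      · rw [h]
        exact hs0
  | h₃ p hp => rw [H.punctured_of hp]; exact tendsto_bot

theorem tendsto_mul (a b : H.Ext) :
    Tendsto (fun p : H.Ext × H.Ext => p.1 * p.2) (H.punctured a ×ˢ H.punctured b)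
      (𝓝 (a * b)) := by
  let E (j : ℕ) : Set H.Ext := {x | ∃ n k, 1 ≤ k ∧ 2 * k * j ≤ n ∧ Ext.of (H.hump n k) = x}
  have hE (j : ℕ) (a : H.Ext) : E j ∈ H.punctured a := by
    induction a using H.forall_ext with
    | h₁ =>
      refine H.eventually_limit.2 ?_
      filter_upwards [eventually_hyperfilter_gt (2 * j)] with n hn
      exact ⟨n, 1, le_rfl, by omega, rfl⟩
    | h₂ =>
      rw [punctured_zero]
      exact ⟨2 * j, fun n k hk hn => ⟨n, k, by omega, by linarith, rfl⟩⟩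
    | h₃ p hp => rw [H.punctured_of hp]; exact mem_bot
  have hlim : Tendsto (fun p : H.Ext × H.Ext => p.1 * p.2) (H.punctured a ×ˢ H.punctured b)
      (𝓝 (Ext.of H.zero)) := by
    rw [H.nhds_eq, punctured_zero]
    rintro s ⟨hs0, j, hj⟩
    rw [mem_map]
    filter_upwards [prod_mem_prod (hE j a) (hE j b)]
    rintro ⟨_, _⟩ ⟨⟨n, k, hk, hn, rfl⟩, m, l, hl, hm, rfl⟩
    change Ext.of (H.hump n k * H.hump m l) ∈ s
    by_cases hnm : n = m
    · subst hnm
      rw [H.hump_mul_self]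
      exact hj n (k + l) (by omega) (by nlinarith)
    · rw [H.hump_mul_ne n m k l hnm]
      exact hs0
  induction a using H.forall_ext with
  | h₃ p hp => rw [H.punctured_of hp, bot_prod]; exact tendsto_bot
  | h₂ => rwa [of_zero_mul]
  | h₁ =>
    induction b using H.forall_ext with
    | h₃ p hp => rw [H.punctured_of hp, prod_bot]; exact tendsto_bot
    | h₂ => rwa [mul_comm, of_zero_mul]
    | h₁ => exact hlim

instance : ContinuousMul H.Ext :=
  continuousMul_of_nhds_eq_pure_sup H.nhds_eq H.tendsto_mul_left H.tendsto_mul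

theorem not_absolutelyTzSClosed (H : HumpSystem Q) : ¬ AbsolutelyTzSClosed Q := fun hQ => by
  have hc := hQ H.Ext H.hasClopenBasis { toFun := Ext.of, map_mul' := fun _ _ => rfl }
  have : (Ext.limit : H.Ext) ∈ closure (Set.range (Ext.of : Q → H.Ext)) := by
    have hm : (Set.range (Ext.of : Q → H.Ext)) ∈ H.punctured Ext.limit :=
      H.eventually_limit.2 (.of_forall fun n => mem_range_self _)
    have : (H.punctured Ext.limit).NeBot := map_neBot
    rw [mem_closure_iff_frequently, H.nhds_eq]
    exact (Eventually.frequently hm).filter_mono le_sup_right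
  obtain ⟨p, hp⟩ := hc.closure_eq ▸ this
  cases hp

end HumpSystem

section

variable {X : Type u} [Semigroup X]

/-- The homomorphism of raising the `n`-th coordinate to the power `n !`. -/
noncomputable def factorialPowHom {G : ℕ → Type u} [∀ n, CommGroup (G n)]
    (φ : ∀ n, X →ₙ* WithZero (G n)) : X →ₙ* ∀ n, WithZero (G n) where
  toFun x n := φ n x ^ n.factorial
  map_mul' x y := funext fun n => by simp [mul_pow]

/-- Homomorphisms to groups with zero, living on disjoint pieces, have bounded exponents. -/
theorem AbsolutelyTzSClosed.false_of_disjoint_unbounded (hX : AbsolutelyTzSClosed X)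
    {G : ℕ → Type u} [∀ n, CommGroup (G n)] (φ : ∀ n, X →ₙ* WithZero (G n)) (x : ℕ → X)
    (t : ∀ n, G n) (hx : ∀ n, φ n (x n) = t n) (hx' : ∀ m n, m ≠ n → φ m (x n) = 0)
    (ht : ∀ n k, 1 ≤ k → k ≤ n → t n ^ (k * n.factorial) ≠ 1) : False := by
  classical
  let ψ := factorialPowHom φ
  have hψ (y : X) (n : ℕ) : ψ y n = φ n y ^ n.factorial := rfl
  have hQ := hX.of_surjective ψ.srangeRestrict ψ.srangeRestrict_surjective
  let v (n k : ℕ) : ∀ n, WithZero (G n) :=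
    Function.update 0 n (((t n ^ n.factorial) ^ k : G n) : WithZero (G n))
  have hv (n k : ℕ) : v n k n = (((t n ^ n.factorial) ^ k : G n) : WithZero (G n)) :=
    Function.update_self ..
  have hv' (n k m : ℕ) (h : m ≠ n) : v n k m = 0 := Function.update_of_ne h ..
  have hmem (n k : ℕ) : v n k ∈ ψ.srange := by
    obtain ⟨o, ho, hto⟩ := isOfFinOrder_iff_pow_eq_one.1 (hX.isOfFinOrder (φ n) (hx n))
    refine ⟨spow (x n) (o + k - 1), funext fun m => ?_⟩
    rw [hψ, map_spow, spow_eq_pow, Nat.sub_add_cancel (by omega)]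
    by_cases hm : m = n
    · subst hm
      rw [hv, hx, pow_add, ← WithZero.coe_pow, hto, WithZero.coe_one, one_mul, ← pow_mul,
        mul_comm k, pow_mul]
      simp
    · rw [hv' n k m hm, hx' m n hm, zero_pow (by omega), zero_pow (Nat.factorial_ne_zero m)]
  have hzero : (0 : ∀ n, WithZero (G n)) ∈ ψ.srange := by
    refine ⟨x 0 * x 1, funext fun m => ?_⟩
    rw [hψ, map_mul]
    rcases eq_or_ne m 0 with rfl | h
    · rw [hx' 0 1 (by simp), mul_zero, zero_pow (Nat.factorial_ne_zero _)]; rfl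
    · rw [hx' m 0 h, zero_mul, zero_pow (Nat.factorial_ne_zero m)]; rfl
  have h01 (y : X) : ∃ N, ∀ n, N ≤ n → ψ y n = 1 ∨ ψ y n = 0 := by
    obtain ⟨N, hN⟩ := hX.exists_spow_map_idem (MulHom.pi φ) y
    refine ⟨N + 1, fun n hn => ?_⟩
    have h1 : (φ n y ^ (N + 1)) * φ n y ^ (N + 1) = φ n y ^ (N + 1) := by
      have := congrFun hN n
      rw [← map_spow, Pi.mul_apply] at this
      change φ n (spow y N) * φ n (spow y N) = φ n (spow y N) at this
      rwa [map_spow, spow_eq_pow] at this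
    obtain ⟨d, hd⟩ := Nat.dvd_factorial N.succ_pos hn
    rw [hψ]
    rcases eq_or_ne (φ n y) 0 with h | h
    · right
      rw [h, zero_pow (Nat.factorial_ne_zero n)]
    · left
      rw [hd, pow_mul, mul_eq_left₀ (pow_ne_zero _ h) |>.1 h1, one_pow]
  refine HumpSystem.not_absolutelyTzSClosed (Q := ψ.srange) ?_ hQ
  exact
    { zero := ⟨0, hzero⟩
      hump := fun n k => ⟨v n k, hmem n k⟩
      mul_zero := fun p => Subtype.ext (mul_zero p.1)
      hump_ne_zero := fun n k h => by
        have := congrFun (congrArg Subtype.val h) n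
        change v n k n = 0 at this
        rw [hv] at this
        exact WithZero.coe_ne_zero this
      hump_mul_self := fun n k l => Subtype.ext <| funext fun m => by
        change v n k m * v n l m = v n (k + l) m
        by_cases hm : m = n
        · subst hm
          rw [hv, hv, hv, pow_add, WithZero.coe_mul]
        · rw [hv' n k m hm, zero_mul, hv' _ _ m hm]
      hump_mul_ne := fun n m k l hnm => Subtype.ext <| funext fun i => by
        change v n k i * v m l i = 0
        by_cases hi : i = n
        · rw [hv' m l i (hi ▸ hnm), mul_zero]
        · rw [hv' n k i hi, zero_mul]
      eq_of_hump_eq := fun n m k l h => by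
        by_contra hnm
        have := congrFun (congrArg Subtype.val h) n
        change v n k n = v m l n at this
        rw [hv, hv' m l n hnm] at this
        exact WithZero.coe_ne_zero this
      hump_one_ne := fun n k hk hkn h => by
        have := congrFun (congrArg Subtype.val h) n
        change v n 1 n = v n k n at this
        rw [hv, hv, WithZero.coe_inj] at this
        obtain ⟨k, rfl⟩ := Nat.exists_eq_add_of_le' (show 1 ≤ k by omega)
        rw [pow_one, pow_succ, right_eq_mul, ← pow_mul] at this
        exact ht n k (by omega) (by omega) (by rwa [mul_comm])
      eventually_mul := by
        rintro ⟨_, y, rfl⟩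
        obtain ⟨N, hN⟩ := h01 y
        filter_upwards [eventually_ge_atTop N] with n hn
        refine (hN n hn).imp (fun h k => Subtype.ext <| funext fun m => ?_)
          fun h k => Subtype.ext <| funext fun m => ?_
        · change ψ y m * v n k m = v n k m
          by_cases hm : m = n
          · subst hm
            rw [h, one_mul]
          · rw [hv' n k m hm, mul_zero]
        · change ψ y m * v n k m = 0
          by_cases hm : m = n
          · subst hm
            rw [h, zero_mul]
          · rw [hv' n k m hm, mul_zero] }

end

section

variable {X : Type u} [Semigroup X]

theorem exists_groupHom (e : Idem (idealCenter X)) :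
    ∃ (G : Type u) (_ : CommGroup G) (φ : X →ₙ* WithZero G),
      (∀ g : G, ∃ x ∈ idealCenter X, φ x = g) ∧ φ e.1 = 1 ∧
      (∀ x y, φ x ≠ 0 → φ x = φ y → e.1 * x = e.1 * y) ∧ ∀ x, φ x ≠ 0 ↔ InvMod e x := by
  have he : (e.1 : X) * e.1 = e.1 := congrArg Subtype.val e.2
  obtain ⟨G, _, φ, h0, h1, h2, h3⟩ := exists_localization e.1.2
  have hφe : φ e.1 = 1 := by
    have := congrArg φ he
    rw [map_mul] at this
    exact (mul_eq_left₀ h0).1 this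
  refine ⟨G, _, φ, h3 he, hφe, fun x y hx hxy => ?_, fun x => ⟨fun hx => ?_, ?_⟩⟩
  · obtain ⟨n, hn⟩ := h1 x y hx hxy
    rwa [spow_of_idem he] at hn
  · obtain ⟨y, hy, n, hn⟩ := h2 x hx
    exact ⟨y, hy, by rw [hn, spow_of_idem he]⟩
  · rintro ⟨y, -, hy⟩ h
    rw [← hy, map_mul, h, zero_mul] at hφe
    exact zero_ne_one hφe

theorem AbsolutelyTzSClosed.finite_setOf_invMod (hX : AbsolutelyTzSClosed X)
    (e : Idem (idealCenter X)) : {x : X | e.1 * x = x ∧ InvMod e x}.Finite := by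
  obtain ⟨G, _, φ, h1, -, h3, h4⟩ := exists_groupHom e
  have hG : Finite G := hX.finite_of_surjective φ fun g => (h1 g).imp fun x hx => hx.2
  have : Finite (WithZero G) := inferInstanceAs (Finite (Option G))
  refine Finite.of_injOn (f := φ) (t := univ) (fun _ _ => mem_univ _) ?_ finite_univ
  rintro x ⟨hx, hx'⟩ y ⟨hy, -⟩ hxy
  rw [← hx, ← hy]
  exact h3 x y ((h4 x).2 hx') hxy

attribute [local instance] Ultrafilter.mul Ultrafilter.semigroup

theorem mem_ultrafilter_mul (U V : Ultrafilter X) (s : Set X) :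
    s ∈ U * V ↔ ∀ᶠ x in U, ∀ᶠ y in V, x * y ∈ s := Ultrafilter.eventually_mul U V (· ∈ s)

theorem continuousAt_ultrafilter_mul {Y : Subsemigroup (Ultrafilter X)} {p q : Y}
    (h : ∀ s ∈ p.1 * q.1, ∃ t ∈ p.1, ∃ t' ∈ q.1, ∀ p' q' : Ultrafilter X, t ∈ p' → t' ∈ q' →
      s ∈ p' * q') : ContinuousAt (fun p : Y × Y => p.1 * p.2) (p, q) := by
  refine IsInducing.subtypeVal.continuousAt_iff.2 ?_
  refine (ultrafilterBasis_is_basis.nhds_hasBasis.tendsto_right_iff).2 ?_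
  rintro _ ⟨⟨s, rfl⟩, hs⟩
  obtain ⟨t, ht, t', ht', hst⟩ := h s hs
  have h1 : ∀ᶠ p' : Y in 𝓝 p, t ∈ p'.1 :=
    continuous_subtype_val.continuousAt ((ultrafilter_isOpen_basic t).mem_nhds ht)
  have h2 : ∀ᶠ p' : Y in 𝓝 q, t' ∈ p'.1 :=
    continuous_subtype_val.continuousAt ((ultrafilter_isOpen_basic t').mem_nhds ht')
  rw [nhds_prod_eq]
  filter_upwards [h1.prod_mk h2] with r hr using hst _ _ hr.1 hr.2

theorem hasClopenBasis_ultrafilter (α : Type*) : HasClopenBasis (Ultrafilter α) := by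
  refine ⟨ultrafilterBasis α, ?_, ultrafilterBasis_is_basis⟩
  rintro _ ⟨s, rfl⟩
  exact ⟨ultrafilter_isClosed_basic s, ultrafilter_isOpen_basic s⟩

/-- An absolutely closed semigroup contains no infinite central set with constant products. -/
theorem AbsolutelyTzSClosed.finite_of_mul_eq (hX : AbsolutelyTzSClosed X) {A : Set X}
    (hA : ∀ a ∈ A, ∀ x, a * x = x * a) (c : X) (hc : ∀ a ∈ A, ∀ b ∈ A, a * b = c) : A.Finite := by
  by_contra hinf
  have hne : (cofinite ⊓ 𝓟 A).NeBot := cofinite_inf_principal_neBot_iff.2 hinf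
  let U : Ultrafilter X := Ultrafilter.of (cofinite ⊓ 𝓟 A)
  have hU : (U : Filter X) ≤ cofinite ⊓ 𝓟 A := Ultrafilter.of_le _
  have hAU : A ∈ U := hU (mem_inf_of_right (mem_principal_self A))
  let L (o : Option X) (a : X) : X := o.elim a (· * a)
  have hLL {o o' : Option X} {a b : X} (ha : a ∈ A) (hb : b ∈ A) :
      L o a * L o' b = L o (L o' c) := by
    rcases o with _ | y <;> rcases o' with _ | z
    · exact hc a ha b hb
    · change a * (z * b) = z * c
      rw [hA a ha, mul_assoc, hc b hb a ha]
    · change y * a * b = y * c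
      rw [mul_assoc, hc a ha b hb]
    · change y * a * (z * b) = y * (z * c)
      rw [mul_assoc, hA a ha, mul_assoc z, hc b hb a ha]
  have hpure (x : X) (s : Set X) : s ∈ (pure x : Ultrafilter X) ↔ x ∈ s := Iff.rfl
  have hTT (o o' : Option X) : U.map (L o) * U.map (L o') = pure (L o (L o' c)) := by
    ext s
    rw [mem_ultrafilter_mul, hpure]
    change (∀ᶠ a in U, ∀ᶠ b in U, L o a * L o' b ∈ s) ↔ _
    constructor
    · intro h
      obtain ⟨a, ha, haA⟩ := (h.and hAU).exists
      obtain ⟨b, hb, hbA⟩ := (ha.and hAU).exists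
      rwa [hLL haA hbA] at hb
    · intro h
      filter_upwards [hAU] with a ha
      filter_upwards [hAU] with b hb
      rwa [hLL ha hb]
  let Y : Subsemigroup (Ultrafilter X) :=
    { carrier := {V | (∃ x, V = pure x) ∨ ∃ o, V = U.map (L o)}
      mul_mem' := by
        rintro _ _ (⟨x, rfl⟩ | ⟨o, rfl⟩) (⟨y, rfl⟩ | ⟨o', rfl⟩)
        · exact Or.inl ⟨x * y, rfl⟩
        · right
          cases o' with
          | none => exact ⟨some x, rfl⟩
          | some y =>
            refine ⟨some (x * y), Ultrafilter.ext fun s => ?_⟩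
            rw [mem_ultrafilter_mul]
            change (∀ᶠ a in U, x * (y * a) ∈ s) ↔ ∀ᶠ a in U, x * y * a ∈ s
            simp only [mul_assoc]
        · right
          refine ⟨some (o.elim y (· * y)), Ultrafilter.ext fun s => ?_⟩
          rw [mem_ultrafilter_mul]
          change (∀ᶠ a in U, L o a * y ∈ s) ↔ ∀ᶠ a in U, o.elim y (· * y) * a ∈ s
          refine eventually_congr ?_
          filter_upwards [hAU] with a ha
          cases o with
          | none =>
            change a * y ∈ s ↔ y * a ∈ s
            rw [hA a ha]
          | some x =>
            change x * a * y ∈ s ↔ x * y * a ∈ s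
            rw [mul_assoc, hA a ha, mul_assoc]
        · exact Or.inl ⟨_, hTT o o'⟩ }
  have hcont : ContinuousMul Y := by
    refine ⟨continuous_iff_continuousAt.2 ?_⟩
    rintro ⟨⟨p, hp⟩, ⟨q, hq⟩⟩
    refine continuousAt_ultrafilter_mul fun s hs => ?_
    change s ∈ p * q at hs
    change ∃ t ∈ p, ∃ t' ∈ q, _
    rcases hp with ⟨x, rfl⟩ | ⟨o, rfl⟩
    · refine ⟨{x}, rfl, {y | x * y ∈ s}, hs, fun p' q' hp' hq' => ?_⟩
      rw [mem_ultrafilter_mul]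
      filter_upwards [hp'] with x' hx'
      rw [hx']
      exact hq'
    · rcases hq with ⟨y, rfl⟩ | ⟨o', rfl⟩
      · refine ⟨{x | x * y ∈ s}, hs, {y}, rfl, fun p' q' hp' hq' => ?_⟩
        rw [mem_ultrafilter_mul]
        filter_upwards [hp'] with x' hx'
        filter_upwards [hq'] with y' hy'
        rw [hy']
        exact hx'
      · rw [hTT] at hs
        refine ⟨L o '' A, image_mem_map hAU, L o' '' A, image_mem_map hAU,
          fun p' q' hp' hq' => ?_⟩
        rw [mem_ultrafilter_mul]
        filter_upwards [hp']
        rintro _ ⟨a, ha, rfl⟩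
        filter_upwards [hq']
        rintro _ ⟨b, hb, rfl⟩
        rw [hLL ha hb]
        exact hs
  have hY : HasClopenBasis Y := .of_isInducing IsInducing.subtypeVal (hasClopenBasis_ultrafilter X)
  have hclosed := hX Y hY
    { toFun := fun x => ⟨pure x, Or.inl ⟨x, rfl⟩⟩, map_mul' := fun _ _ => rfl }
  have hmem : U.map (L none) = U := Ultrafilter.map_id U
  have : (⟨U, Or.inr ⟨none, hmem.symm⟩⟩ : Y) ∈
      closure (Set.range fun x : X => (⟨pure x, Or.inl ⟨x, rfl⟩⟩ : Y)) := by
    refine mem_closure_of_tendsto (f := fun x : X => (⟨pure x, Or.inl ⟨x, rfl⟩⟩ : Y)) (b := U) ?_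
      (.of_forall fun x => mem_range_self x)
    exact tendsto_subtype_rng.2 (Ultrafilter.tendsto_pure_self U)
  obtain ⟨x, hx⟩ := hclosed.closure_eq ▸ this
  have hx : (pure x : Ultrafilter X) = U := congrArg Subtype.val hx
  have h1 : {x}ᶜ ∈ U := hU (mem_inf_of_left (finite_singleton x).compl_mem_cofinite)
  rw [← hx] at h1
  exact h1 rfl

/-- An absolutely closed semigroup contains no infinite central set outside an ideal with
products in the ideal. -/
theorem AbsolutelyTzSClosed.finite_of_mul_mem (hX : AbsolutelyTzSClosed X) {J : Set X}
    (hJ : IsIdealSet X J) {A : Set X} (hA : ∀ a ∈ A, ∀ x, a * x = x * a) (hAJ : ∀ a ∈ A, a ∉ J)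
    (hAA : ∀ a ∈ A, ∀ b ∈ A, a * b ∈ J) : A.Finite := by
  rcases A.eq_empty_or_nonempty with rfl | ⟨a, ha⟩
  · exact finite_empty
  let π : X →ₙ* (ReesCon J hJ).Quotient := { toFun := (↑), map_mul' := fun _ _ => rfl }
  have hπs : Function.Surjective π := Quotient.mk''_surjective
  have hπ {x y : X} : π x = π y ↔ x = y ∨ x ∈ J ∧ y ∈ J := (ReesCon J hJ).eq
  have hinj : InjOn π A := fun x hx y _ h => (hπ.1 h).resolve_right fun h => hAJ x hx h.1
  refine Finite.of_finite_image ?_ hinj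
  refine (hX.of_surjective π hπs).finite_of_mul_eq ?_ (π (a * a)) ?_
  · rintro _ ⟨b, hb, rfl⟩ y
    obtain ⟨y, rfl⟩ := hπs y
    rw [← map_mul, hA b hb, map_mul]
  · rintro _ ⟨b, hb, rfl⟩ _ ⟨c, hc, rfl⟩
    rw [← map_mul]
    exact hπ.2 (Or.inr ⟨hAA b hb c hc, hAA a ha a ha⟩)

end

section

variable {X : Type u} [Semigroup X]

theorem IsIdealSet.union {I J : Set X} (hI : IsIdealSet X I) (hJ : IsIdealSet X J) :
    IsIdealSet X (I ∪ J) := by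
  rintro x (hx | hx) y
  · exact ⟨Or.inl (hI x hx y).1, Or.inl (hI x hx y).2⟩
  · exact ⟨Or.inr (hJ x hx y).1, Or.inr (hJ x hx y).2⟩

theorem IsIdealSet.iUnion {ι : Type*} {I : ι → Set X} (hI : ∀ i, IsIdealSet X (I i)) :
    IsIdealSet X (⋃ i, I i) := by
  intro x hx y
  obtain ⟨i, hi⟩ := mem_iUnion.1 hx
  exact ⟨mem_iUnion.2 ⟨i, (hI i x hi y).1⟩, mem_iUnion.2 ⟨i, (hI i x hi y).2⟩⟩

theorem IsIdealSet.spow_mem {J : Set X} (hJ : IsIdealSet X J) {x : X} {m n : ℕ} (hmn : m ≤ n)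
    (hx : spow x m ∈ J) : spow x n ∈ J := by
  obtain ⟨k, rfl⟩ := Nat.exists_eq_add_of_le hmn
  induction k with
  | zero => exact hx
  | succ k ih => exact (hJ _ (ih (by omega)) x).1

/-- The principal ideal generated by a central element. -/
def principalIdeal (a : X) : Set X := {y | y = a ∨ ∃ x, y = a * x}

theorem mem_principalIdeal_self (a : X) : a ∈ principalIdeal a := Or.inl rfl

theorem mul_mem_principalIdeal (a x : X) : a * x ∈ principalIdeal a := Or.inr ⟨x, rfl⟩

theorem isIdealSet_principalIdeal {a : X} (ha : a ∈ idealCenter X) :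
    IsIdealSet X (principalIdeal a) := by
  rintro _ (rfl | ⟨x, rfl⟩) y
  · refine ⟨Or.inr ⟨y, rfl⟩, Or.inr ⟨y, (mul_comm_of_mem_idealCenter ha y).symm⟩⟩
  · exact ⟨Or.inr ⟨x * y, mul_assoc _ _ _⟩, Or.inr ⟨y * x, by
      rw [← mul_assoc, ← mul_comm_of_mem_idealCenter ha, mul_assoc]⟩⟩

theorem mem_idealCenter_of_mem_principalIdeal {a x : X} (ha : a ∈ idealCenter X)
    (hx : x ∈ principalIdeal a) : x ∈ idealCenter X := by
  rcases hx with rfl | ⟨y, rfl⟩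
  exacts [ha, mul_mem_idealCenter ha y]

theorem mul_mem_principalIdeal_mul {a b x y : X} (hb : b ∈ idealCenter X)
    (hx : x ∈ principalIdeal a) (hy : y ∈ principalIdeal b) : x * y ∈ principalIdeal (a * b) := by
  rcases hx with rfl | ⟨x, rfl⟩ <;> rcases hy with rfl | ⟨y, rfl⟩
  · exact Or.inl rfl
  · exact Or.inr ⟨y, (mul_assoc _ _ _).symm⟩
  · exact Or.inr ⟨x, by rw [mul_assoc, ← mul_comm_of_mem_idealCenter hb, mul_assoc]⟩
  · refine Or.inr ⟨x * y, ?_⟩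
    rw [mul_assoc, mul_assoc, ← mul_assoc x, ← mul_comm_of_mem_idealCenter hb x, mul_assoc]

/-- The elements of the ideal center having a power in `J`. -/
def nilSet (J : Set X) : Set X := {x | x ∈ idealCenter X ∧ ∃ k, spow x k ∈ J}

theorem mul_mem_nilSet {J : Set X} (hJ : IsIdealSet X J) {a : X} (ha : a ∈ nilSet J) (x : X) :
    a * x ∈ nilSet J := by
  obtain ⟨k, hk⟩ := ha.2
  refine ⟨mul_mem_idealCenter ha.1 x, k, ?_⟩
  rw [mul_spow_of_central (mul_comm_of_mem_idealCenter ha.1)]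
  exact (hJ _ hk _).1

theorem mem_of_mul_eq_self {J : Set X} (hJ : IsIdealSet X J) {x w : X} (hw : w ∈ nilSet J)
    (h : x * w = x) : x ∈ J := by
  have h1 (n : ℕ) : x * spow w n = x := by
    induction n with
    | zero => exact h
    | succ n ih => rw [spow, ← mul_assoc, ih, h]
  obtain ⟨k, hk⟩ := hw.2
  rw [← h1 k]
  exact (hJ _ hk x).2

theorem AbsolutelyTzSClosed.finite_principalIdeal_diff (hX : AbsolutelyTzSClosed X) {J : Set X}
    (hJ : IsIdealSet X J) {a : X} (ha : a ∈ nilSet J) : (principalIdeal a \ J).Finite := by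
  obtain ⟨ha, k, hk⟩ := ha
  induction k using Nat.strong_induction_on generalizing a with
  | _ k ih =>
    rcases Nat.eq_zero_or_pos k with rfl | hk0
    · have : principalIdeal a ⊆ J := by
        rintro _ (rfl | ⟨x, rfl⟩)
        exacts [hk, (hJ a hk x).1]
      rw [sdiff_eq_empty.2 this]
      exact finite_empty
    have haa := mul_mem_idealCenter ha a
    have h1 : (principalIdeal (a * a) \ J).Finite := by
      refine ih (k / 2) (by omega) haa ?_
      change spow (spow a 1) (k / 2) ∈ J
      rw [spow_spow]
      exact hJ.spow_mem (by omega) hk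
    have h2 : (principalIdeal a \ (J ∪ principalIdeal (a * a))).Finite :=
      hX.finite_of_mul_mem (hJ.union (isIdealSet_principalIdeal haa))
        (fun b hb => mul_comm_of_mem_idealCenter (mem_idealCenter_of_mem_principalIdeal ha hb.1))
        (fun b hb => hb.2)
        fun b hb c hc => Or.inr (mul_mem_principalIdeal_mul ha hb.1 hc.1)
    refine (h1.union h2).subset fun x hx => ?_
    by_cases hx' : x ∈ principalIdeal (a * a)
    · exact Or.inl ⟨hx', hx.2⟩
    · exact Or.inr ⟨hx.1, fun h => h.elim hx.2 hx'⟩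

theorem AbsolutelyTzSClosed.finite_nilSet_diff (hX : AbsolutelyTzSClosed X) {J : Set X}
    (hJ : IsIdealSet X J) : (nilSet J \ J).Finite := by
  by_contra hinf
  obtain ⟨a, ha, hlt⟩ := exists_seq_of_forall_finset_exists (fun x => x ∈ nilSet J \ J)
    (fun x y => y ∉ principalIdeal x) fun s hs => by
      have hfin : (⋃ x ∈ s, principalIdeal x \ J).Finite :=
        s.finite_toSet.biUnion fun x hx => hX.finite_principalIdeal_diff hJ (hs x hx).1
      obtain ⟨y, hy, hys⟩ := (Set.Infinite.sdiff hinf hfin).nonempty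
      exact ⟨y, hy, fun x hx hxy => hys (mem_biUnion hx ⟨hxy, hy.2⟩)⟩
  have hinj : Function.Injective a := by
    intro m n h
    by_contra hmn
    rcases Nat.lt_or_gt_of_ne hmn with hmn | hmn
    · exact hlt m n hmn (h ▸ mem_principalIdeal_self _)
    · exact hlt n m hmn (h ▸ mem_principalIdeal_self _)
  have haS (n : ℕ) : a n ∈ idealCenter X := (ha n).1.1
  let I : Set X := J ∪ ⋃ p : ℕ × ℕ, principalIdeal (a p.1 * a p.2)
  have hI : IsIdealSet X I :=
    hJ.union (.iUnion fun p => isIdealSet_principalIdeal (mul_mem (haS _) (haS _)))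
  obtain ⟨N, hN⟩ : ∃ N, ∀ n, N ≤ n → a n ∈ I := by
    have hfin : (Set.range a \ I).Finite := by
      refine hX.finite_of_mul_mem hI ?_ (fun b hb => hb.2) ?_
      · rintro _ ⟨⟨n, rfl⟩, -⟩
        exact mul_comm_of_mem_idealCenter (haS n)
      · rintro _ ⟨⟨m, rfl⟩, -⟩ _ ⟨⟨n, rfl⟩, -⟩
        exact Or.inr (mem_iUnion.2 ⟨(m, n), mem_principalIdeal_self _⟩)
    obtain ⟨N, hN⟩ := (hfin.preimage hinj.injOn).bddAbove
    refine ⟨N + 1, fun n hn => ?_⟩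
    by_contra hnI
    exact absurd (hN ⟨mem_range_self n, hnI⟩) (by omega)
  have hfac (n : ℕ) (hn : N ≤ n) : ∃ i, N ≤ i ∧ ∃ w ∈ nilSet J, a n = a i * w := by
    obtain ⟨⟨i, j⟩, hij⟩ := mem_iUnion.1 ((hN n hn).resolve_left (ha n).2)
    obtain ⟨w, hw, h⟩ : ∃ w ∈ nilSet J, a n = a i * w := by
      rcases hij with h | ⟨x, h⟩
      · exact ⟨a j, (ha j).1, h⟩
      · exact ⟨a j * x, mul_mem_nilSet hJ (ha j).1 x, by rw [h, mul_assoc]⟩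
    refine ⟨i, hn.trans (not_lt.1 fun hin => hlt i n hin ?_), w, hw, h⟩
    rw [h]
    exact mul_mem_principalIdeal _ _
  have hann (c : X) (hc : c ∈ nilSet J) (n : ℕ) (hn : N ≤ n) : c * a n ∈ J := by
    by_contra hcn
    let r (x y : X) : Prop := x ∉ J ∧ y ∉ J ∧ ∃ w ∈ nilSet J, y = x * w
    have _ : IsStrictOrder X r :=
      { irrefl := fun x ⟨hx, _, w, hw, h⟩ => hx (mem_of_mul_eq_self hJ hw h.symm)
        trans := by
          rintro x _ _ ⟨hx, -, v, hv, rfl⟩ ⟨-, hz, w, hw, rfl⟩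
          exact ⟨hx, hz, v * w, mul_mem_nilSet hJ hv w, mul_assoc _ _ _⟩ }
    have hfin : {d | d ∉ J ∧ ∃ n, N ≤ n ∧ d = c * a n}.Finite := by
      refine (hX.finite_principalIdeal_diff hJ hc).subset ?_
      rintro _ ⟨hd, n, -, rfl⟩
      exact ⟨mul_mem_principalIdeal _ _, hd⟩
    obtain ⟨⟨_, hm, m, hNm, rfl⟩, -, hmin⟩ :=
      (hfin.wellFoundedOn (r := r)).has_min univ ⟨⟨_, hcn, n, hn, rfl⟩, mem_univ _⟩
    obtain ⟨i, hi, w, hw, h⟩ := hfac m hNm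
    have hci : c * a i ∉ J := fun hJi => hm (by
      rw [h, ← mul_assoc]
      exact (hJ _ hJi w).1)
    exact hmin ⟨c * a i, hci, i, hi, rfl⟩ (mem_univ _)
      ⟨hci, hm, w, hw, (congrArg (c * ·) h).trans (mul_assoc _ _ _).symm⟩
  obtain ⟨i, hi, w, hw, h⟩ := hfac N le_rfl
  refine (ha N).2 ?_
  rw [h, mul_comm_of_mem_idealCenter (haS i)]
  exact hann w hw i hi

end

section

variable {X : Type u} [Semigroup X]

/-- An element lying in a periodic subgroup. -/
def IsPeriodicUnit (x : X) : Prop := ∃ k, spow x k * spow x k = spow x k ∧ spow x k * x = x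

theorem Idem.val_mul_val (e : Idem (idealCenter X)) : (e.1 : X) * e.1 = e.1 :=
  congrArg Subtype.val e.2

theorem Idem.val_comm (e : Idem (idealCenter X)) (x : X) : (e.1 : X) * x = x * e.1 :=
  mul_comm_of_mem_idealCenter e.1.2 x

/-- The idempotent of the ideal center given by an idempotent element. -/
def Idem.mk' {x : X} (hx : x ∈ idealCenter X) (h : x * x = x) : Idem (idealCenter X) :=
  ⟨⟨x, hx⟩, Subtype.ext h⟩

theorem Idem.val_le_iff {e f : Idem (idealCenter X)} : e ≤ f ↔ (e.1 : X) * f.1 = e.1 :=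
  Subtype.ext_iff

theorem AbsolutelyTzSClosed.finite_of_antichain (hX : AbsolutelyTzSClosed X)
    (A : Set (Idem (idealCenter X))) (hA : ∀ e ∈ A, ∀ f ∈ A, e ≤ f → e = f) :
    {x : X | x ∈ idealCenter X ∧ ¬ IsPeriodicUnit x ∧
      ∃ e ∈ A, e.1 * x = x ∧ ∀ f < e, f.1 * x ≠ x}.Finite := by
  let J : Set X := {y | ∀ e ∈ A, ∃ f < e, (f.1 : X) * (e.1 * y) = e.1 * y}
  have hJ : IsIdealSet X J := by
    refine fun x hx y => ⟨fun e he => ?_, fun e he => ?_⟩ <;> obtain ⟨f, hf, h⟩ := hx e he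
    · refine ⟨f, hf, ?_⟩
      rw [← mul_assoc (e.1 : X), ← mul_assoc, h]
    · refine ⟨f, hf, ?_⟩
      rw [← mul_assoc (e.1 : X), e.val_comm y, mul_assoc, ← mul_assoc, f.val_comm y, mul_assoc, h]
  refine (hX.finite_nilSet_diff hJ).subset ?_
  rintro x ⟨hxS, hx, e, he, hex, hmin⟩
  refine ⟨⟨hxS, ?_⟩, fun h => ?_⟩
  · obtain ⟨k, hk⟩ := hX.exists_spow_idem hxS
    let p : Idem (idealCenter X) := .mk' (spow_mem_idealCenter hxS k) hk
    have hpe : p ≤ e := by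
      rw [Idem.val_le_iff, ← e.val_comm]
      exact spow_mul_of_mul_eq hex k
    refine ⟨k, fun f hf => ⟨f ⊓ p, inf_le_left.lt_of_ne fun h => ?_,
      congrArg Subtype.val (f ⊓ p).2⟩⟩
    have hfp : f ≤ p := inf_eq_left.1 h
    obtain rfl := hA f hf e he (hfp.trans hpe)
    obtain rfl := hfp.antisymm hpe
    exact hx ⟨k, hk, hex⟩
  · obtain ⟨f, hf, hfx⟩ := h e he
    rw [hex] at hfx
    exact hmin f hf hfx

theorem AbsolutelyTzSClosed.finite_not_isPeriodicUnit (hX : AbsolutelyTzSClosed X) :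
    {x : X | x ∈ idealCenter X ∧ ¬ IsPeriodicUnit x}.Finite := by
  let J : Set X := {y | ∃ e : Idem (idealCenter X), (e.1 : X) * y = y}
  have hJ : IsIdealSet X J := by
    rintro x ⟨e, he⟩ y
    exact ⟨⟨e, by rw [← mul_assoc, he]⟩, e, by rw [← mul_assoc, e.val_comm, mul_assoc, he]⟩
  by_contra hinf
  have hnil := hX.finite_nilSet_diff hJ
  let x := (Set.Infinite.sdiff hinf hnil).natEmbedding
  have hxS (n : ℕ) : (x n : X) ∈ idealCenter X := (x n).2.1.1
  have hxJ (n : ℕ) : (x n : X) ∈ J := by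
    by_contra h
    obtain ⟨k, hk⟩ := hX.exists_spow_idem (hxS n)
    exact (x n).2.2 ⟨⟨hxS n, k, .mk' (spow_mem_idealCenter (hxS n) k) hk, hk⟩, h⟩
  have hWF := hX.wellFoundedLT
  have hWF' := hX.wellFoundedGT
  choose e he hemin using fun n => wellFounded_lt.has_min
    {e : Idem (idealCenter X) | (e.1 : X) * x n = x n} (hxJ n)
  obtain ⟨g, hg, hg'⟩ := exists_constant_or_antichain e
  have hfin := hX.finite_of_antichain (Set.range (e ∘ g)) (by
    rintro _ ⟨m, rfl⟩ _ ⟨n, rfl⟩ hmn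
    rcases hg' with hc | hc
    · exact (hc m).trans (hc n).symm
    · by_contra h
      exact hc m n (fun h' => h (h' ▸ rfl)) hmn)
  refine Set.infinite_of_injective_forall_mem
    (f := fun n => (x (g n) : X)) (fun m n h => hg.injective (x.injective (Subtype.ext h)))
    (fun n => ?_) hfin
  exact ⟨hxS _, (x (g n)).2.1.2, e (g n), mem_range_self n, he _, fun f hf h => hemin _ f h hf⟩

theorem spow_idem_of_dvd {x : X} {k m : ℕ} (hk : spow x k * spow x k = spow x k)
    (hm : 0 < m) (hkm : k + 1 ∣ m) : spow x (m - 1) * spow x (m - 1) = spow x (m - 1) := by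
  obtain ⟨d, rfl⟩ := hkm
  obtain ⟨d, rfl⟩ := Nat.exists_eq_add_of_le' (Nat.pos_of_mul_pos_left hm)
  rw [← spow_spow, spow_of_idem hk, hk]

theorem exists_factorial_of_finite {F : Set X} (hF : F.Finite)
    (h : ∀ x ∈ F, ∃ k, spow x k * spow x k = spow x k) :
    ∃ n : ℕ, ∀ m, 0 < m → n.factorial ∣ m →
      ∀ x ∈ F, spow x (m - 1) * spow x (m - 1) = spow x (m - 1) := by
  choose! k hk using h
  obtain ⟨n, hn⟩ := (hF.image k).bddAbove
  refine ⟨n + 1, fun m hm hnm x hx => spow_idem_of_dvd (hk x hx) hm ?_⟩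
  exact (Nat.dvd_factorial (Nat.succ_pos _)
    (by have := hn (mem_image_of_mem k hx); omega)).trans hnm

theorem AbsolutelyTzSClosed.exists_spow_idem_of_isPeriodicUnit (hX : AbsolutelyTzSClosed X) :
    ∃ n : ℕ, ∀ x ∈ idealCenter X, IsPeriodicUnit x → spow x n * spow x n = spow x n := by
  by_contra! hcon
  choose x hxS hx hxn using fun n : ℕ => hcon (n.factorial * n.factorial - 1)
  choose k hk hkx using hx
  have hpos (n : ℕ) : 0 < n.factorial * n.factorial :=
    Nat.mul_pos n.factorial_pos n.factorial_pos
  let e (n : ℕ) : Idem (idealCenter X) := .mk' (spow_mem_idealCenter (hxS n) (k n)) (hk n)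
  have hinv (n : ℕ) : InvMod (e n) (x n) := by
    refine ⟨spow (x n) (k n + k n), spow_mem_idealCenter (hxS n) _, ?_⟩
    refine (spow_mul_spow (x n) 0 _).trans ?_
    rw [zero_add, ← spow_mul_spow]
    exact hk n
  have hWF := hX.wellFoundedLT
  have hWF' := hX.wellFoundedGT
  obtain ⟨g, hg, hc | hc⟩ := exists_constant_or_antichain e
  · obtain ⟨n, hn⟩ := exists_factorial_of_finite (hX.finite_setOf_invMod (e (g 0)))
      fun y hy => by
        obtain ⟨G, _, φ, -, hφ, hφ', hinv'⟩ := exists_groupHom (e (g 0))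
        obtain ⟨t, ht⟩ := WithZero.ne_zero_iff_exists.1 ((hinv' y).2 hy.2)
        obtain ⟨j, hj, htj⟩ := isOfFinOrder_iff_pow_eq_one.1 (hX.isOfFinOrder φ ht.symm)
        have h1 : φ (spow y (j - 1)) = φ (e (g 0)).1 := by
          rw [hφ, map_spow, spow_eq_pow, Nat.sub_add_cancel hj, ← ht, ← WithZero.coe_pow, htj,
            WithZero.coe_one]
        have h2 := hφ' _ _ (by rw [h1, hφ]; exact one_ne_zero) h1
        rw [spow_mul_of_mul_eq hy.1, Idem.val_mul_val] at h2
        exact ⟨j - 1, by rw [h2, Idem.val_mul_val]⟩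
    refine hxn (g n) (hn _ (hpos _) ?_ _ ?_)
    · exact (Nat.factorial_dvd_factorial hg.le_apply).mul_right _
    · rw [← hc n]
      exact ⟨hkx _, hinv _⟩
  · choose G hG φ hφs hφe hφ hφi using fun n => exists_groupHom (e (g n))
    choose t ht using fun n => WithZero.ne_zero_iff_exists.1 ((hφi n _).2 (hinv (g n)))
    refine hX.false_of_disjoint_unbounded φ (fun n => x (g n)) t (fun n => (ht n).symm)
      (fun m n hmn => ?_) fun n j hj hjn htj => ?_
    · by_contra h
      have : φ m (e (g n)).1 ≠ 0 := by
        change φ m (spow (x (g n)) (k (g n))) ≠ 0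
        rw [map_spow, spow_eq_pow]
        exact pow_ne_zero _ h
      exact hc m n hmn ((invMod_idem _ _).1 ((hφi m _).1 this))
    · have hdvd : j * n.factorial ∣ (g n).factorial * (g n).factorial :=
        mul_dvd_mul (Nat.dvd_factorial hj (hjn.trans hg.le_apply))
          (Nat.factorial_dvd_factorial hg.le_apply)
      obtain ⟨d, hd⟩ := hdvd
      have h1 : φ n (spow (x (g n)) ((g n).factorial * (g n).factorial - 1)) =
          φ n (e (g n)).1 := by
        rw [hφe, map_spow, spow_eq_pow, Nat.sub_add_cancel (hpos _), ← ht, ← WithZero.coe_pow, hd,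
          pow_mul, htj, one_pow, WithZero.coe_one]
      have h2 := hφ n _ _ (by rw [h1, hφe]; exact one_ne_zero) h1
      rw [spow_mul_of_mul_eq (e := ((e (g n)).1 : X)) (hkx (g n)), Idem.val_mul_val] at h2
      exact hxn (g n) (by rw [h2, Idem.val_mul_val])

theorem AbsolutelyTzSClosed.exists_forall_spow_idem (hX : AbsolutelyTzSClosed X) :
    ∃ n : ℕ, ∀ x ∈ idealCenter X, spow x n * spow x n = spow x n := by
  obtain ⟨m, hm⟩ := hX.exists_spow_idem_of_isPeriodicUnit
  obtain ⟨n, hn⟩ := exists_factorial_of_finite hX.finite_not_isPeriodicUnit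
    fun x hx => hX.exists_spow_idem hx.1
  have hpos : 0 < (m + 1) * n.factorial := Nat.mul_pos m.succ_pos n.factorial_pos
  refine ⟨(m + 1) * n.factorial - 1, fun x hx => ?_⟩
  by_cases hx' : IsPeriodicUnit x
  · exact spow_idem_of_dvd (hm x hx hx') hpos (Dvd.intro _ rfl)
  · exact hn _ hpos (Dvd.intro_left _ rfl) x ⟨hx, hx'⟩

end

section Closure

variable {T Y : Type*} [CommSemigroup T] [Semigroup Y] [TopologicalSpace Y]

/-- A sequence of neighbourhoods of `y` such that the product of the `n + 1`-st one with itself is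
contained in the `n`-th one. -/
structure IsMulSequence (y : Y) (U : ℕ → Set Y) : Prop where
  mem_nhds (n : ℕ) : U n ∈ 𝓝 y
  mul_mem (n : ℕ) (a b : Y) : a ∈ U (n + 1) → b ∈ U (n + 1) → a * b ∈ U n

theorem exists_mem_iInter_of_isMulSequence [WellFoundedLT (Idem T)] [WellFoundedGT (Idem T)]
    (h : T →ₙ* Y) {D : Set (Idem T)} (hD : ∀ e ∈ D, ∀ f ∈ D, e ⊓ f ∈ D) {y : Y}
    (hy : y ∈ closure ((fun e : Idem T => h e.1) '' D)) {U : ℕ → Set Y}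
    (hU : IsMulSequence y U) : ∃ e ∈ D, ∀ n, h e.1 ∈ U n := by
  have hidem (e : Idem T) (n : ℕ) (he : h e.1 ∈ U (n + 1)) : h e.1 ∈ U n := by
    rw [← e.2, map_mul]
    exact hU.mul_mem n _ _ he he
  have hx (n : ℕ) : ∃ e ∈ D, h e.1 ∈ U (n + 1) := by
    obtain ⟨_, hz, e, he, rfl⟩ := mem_closure_iff_nhds.1 hy _ (hU.mem_nhds (n + 1))
    exact ⟨e, he, hz⟩
  choose x hxD hxU using hx
  let Q (k : ℕ) : ℕ → Idem T := Nat.rec x (fun _ q m => x m ⊓ q (m + 1)) k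
  have hQ (k m : ℕ) : Q (k + 1) m = x m ⊓ Q k (m + 1) := rfl
  have hQD (k m : ℕ) : Q k m ∈ D := by
    induction k generalizing m with
    | zero => exact hxD m
    | succ k ih => exact hD _ (hxD m) _ (ih _)
  have hQU (k m : ℕ) : h (Q k m).1 ∈ U m := by
    induction k generalizing m with
    | zero => exact hidem _ _ (hxU m)
    | succ k ih =>
      rw [hQ, Idem.inf_val, map_mul]
      exact hU.mul_mem m _ _ (hxU m) (ih _)
  have hQanti (m : ℕ) : Antitone fun k => Q k m := by
    refine antitone_nat_of_succ_le fun k => ?_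
    induction k generalizing m with
    | zero => exact inf_le_left
    | succ k ih => exact inf_le_inf_left _ (ih _)
  have hmin (m : ℕ) : ∃ K, ∀ k, K ≤ k → Q k m = Q K m := by
    obtain ⟨_, ⟨K, rfl⟩, hK⟩ := wellFounded_lt.has_min (Set.range fun k => Q k m) ⟨_, 0, rfl⟩
    exact ⟨K, fun k hk => by_contra fun hne => hK _ ⟨k, rfl⟩ ((hQanti m hk).lt_of_ne hne)⟩
  choose K hK using hmin
  let p (m : ℕ) : Idem T := Q (K m) m
  have hp : Monotone p := by
    refine monotone_nat_of_le_succ fun m => ?_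
    have h1 := hK m (K m + K (m + 1) + 1) (by omega)
    have h2 := hK (m + 1) (K m + K (m + 1)) (by omega)
    change Q (K m) m ≤ Q (K (m + 1)) (m + 1)
    rw [← h1, ← h2]
    exact inf_le_right
  obtain ⟨_, ⟨M, rfl⟩, hM⟩ := wellFounded_gt.has_min (Set.range p) ⟨_, 0, rfl⟩
  refine ⟨p M, hQD _ _, fun n => ?_⟩
  have h1 : h (p M).1 ∈ U (n + M) := by
    have : p (n + M) = p M := by_contra fun hne =>
      hM _ ⟨n + M, rfl⟩ ((hp (Nat.le_add_left M n)).lt_of_ne' hne)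
    rw [← this]
    exact hQU _ _
  generalize p M = e at h1
  generalize M = j at h1
  induction j with
  | zero => exact h1
  | succ j ih => exact ih (hidem e _ h1)

variable [ContinuousMul Y]

theorem exists_isMulSequence {y : Y} (hy : y * y = y) {B : ℕ → Set Y} (hB : ∀ n, B n ∈ 𝓝 y) :
    ∃ U, IsMulSequence y U ∧ ∀ n, U n ⊆ B n := by
  have hsq (A : Set Y) (hA : A ∈ 𝓝 y) : ∃ C ∈ 𝓝 y, ∀ a ∈ C, ∀ b ∈ C, a * b ∈ A := by
    have : Tendsto (fun p : Y × Y => p.1 * p.2) (𝓝 y ×ˢ 𝓝 y) (𝓝 y) := by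
      have := (continuous_mul (M := Y)).tendsto (y, y)
      rwa [nhds_prod_eq, hy] at this
    obtain ⟨C, hC, h⟩ := mem_prod_same_iff.1 (this hA)
    exact ⟨C, hC, fun a ha b hb => h (mk_mem_prod ha hb)⟩
  choose! C hC hC' using hsq
  let U (n : ℕ) : Set Y := Nat.rec (B 0) (fun k A => C A ∩ B (k + 1)) n
  have hU (n : ℕ) : U n ∈ 𝓝 y := by
    induction n with
    | zero => exact hB 0
    | succ n ih => exact inter_mem (hC _ ih) (hB _)
  refine ⟨U, ⟨hU, fun n a b ha hb => hC' _ (hU n) a ha.1 b hb.1⟩, fun n => ?_⟩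
  cases n with
  | zero => exact Subset.rfl
  | succ n => exact inter_subset_right

/-- The image of a chain-finite semilattice is closed. -/
theorem exists_map_idem_eq [WellFoundedLT (Idem T)] [WellFoundedGT (Idem T)] [T2Space Y]
    (h : T →ₙ* Y) {D : Set (Idem T)} (hD : ∀ e ∈ D, ∀ f ∈ D, e ⊓ f ∈ D) {y : Y}
    (hy : y ∈ closure ((fun e : Idem T => h e.1) '' D)) : ∃ e ∈ D, h e.1 = y := by
  have hyy : y * y = y := by
    have hc : IsClosed {z : Y | z * z = z} :=
      isClosed_eq (continuous_id.mul continuous_id) continuous_id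
    refine closure_minimal ?_ hc hy
    rintro _ ⟨e, -, rfl⟩
    change h e.1 * h e.1 = h e.1
    rw [← map_mul, e.2]
  let S (U : ℕ → Set Y) : Set (Idem T) := {e | e ∈ D ∧ ∀ n, h e.1 ∈ U n}
  have hleast (U : ℕ → Set Y) (hU : IsMulSequence y U) : ∃ e ∈ S U, ∀ f ∈ S U, e ≤ f := by
    obtain ⟨e, he, hmin⟩ := wellFounded_lt.has_min (S U)
      (exists_mem_iInter_of_isMulSequence h hD hy hU)
    refine ⟨e, he, fun f hf => ?_⟩
    have : e ⊓ f ∈ S U := ⟨hD e he.1 f hf.1, fun n => by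
      rw [Idem.inf_val, map_mul]
      exact hU.mul_mem n _ _ (he.2 _) (hf.2 _)⟩
    exact inf_eq_left.1 (by_contra fun hne => hmin _ this (inf_le_left.lt_of_ne hne))
  obtain ⟨U₀, hU₀, -⟩ := exists_isMulSequence hyy fun _ => univ_mem
  obtain ⟨e, ⟨U, hU, heU, hle⟩, hmax⟩ := wellFounded_gt.has_min
    {e | ∃ U, IsMulSequence y U ∧ e ∈ S U ∧ ∀ f ∈ S U, e ≤ f}
    ((hleast U₀ hU₀).imp fun e he => ⟨U₀, hU₀, he⟩)
  refine ⟨e, heU.1, (specializes_iff_pure.2 fun W hW => ?_).eq⟩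
  obtain ⟨V, hV, hVU⟩ := exists_isMulSequence hyy fun n => inter_mem hW (hU.mem_nhds n)
  obtain ⟨f, hf, hfle⟩ := hleast V hV
  have hef : e ≤ f := hle f ⟨hf.1, fun n => (hVU n (hf.2 n)).2⟩
  have : f = e := by_contra fun hne => hmax f ⟨V, hV, hf, hfle⟩ (hef.lt_of_ne' hne)
  rw [← this]
  exact (hVU 0 (hf.2 0)).1

theorem continuous_spow (n : ℕ) : Continuous fun y : Y => spow y n := by
  induction n with
  | zero => exact continuous_id
  | succ n ih => exact ih.mul continuous_id

end Closure

theorem mem_range_of_finite_mem {α Y : Type*} [TopologicalSpace Y] [T2Space Y] {h : α → Y}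
    {y : Y} (U : Ultrafilter α)
    (hU : Tendsto h U (𝓝 y)) {F : Set α} (hF : F.Finite) (hFU : F ∈ U) : y ∈ Set.range h := by
  obtain ⟨x, -, rfl⟩ := Ultrafilter.eq_pure_of_finite_mem hF hFU
  exact ⟨x, tendsto_nhds_unique (tendsto_pure_nhds h x) hU⟩

theorem absolutelyT2SClosed_of_finite (T : Type u) [CommSemigroup T] [WellFoundedLT (Idem T)]
    [WellFoundedGT (Idem T)] (n : ℕ) (hn : ∀ x : T, spow x n * spow x n = spow x n)
    (hB : {x : T | spow x n * x ≠ x}.Finite)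
    (hH : ∀ e : Idem T, {x : T | e.1 * x = x ∧ spow x n = e.1}.Finite) :
    AbsolutelyT2SClosed T := by
  intro Y _ _ _ _ h
  refine isClosed_of_closure_subset fun y hy => ?_
  have hne : (comap h (𝓝 y)).NeBot := comap_neBot fun s hs => by
    obtain ⟨_, hz, x, rfl⟩ := mem_closure_iff_nhds.1 hy s hs
    exact ⟨x, hz⟩
  let U := Ultrafilter.of (comap h (𝓝 y))
  have hU : Tendsto h U (𝓝 y) := tendsto_comap.mono_left (Ultrafilter.of_le _)
  by_cases hBU : {x : T | spow x n * x ≠ x} ∈ U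
  · exact mem_range_of_finite_mem U hU hB hBU
  have hBU : ∀ᶠ x in (U : Filter T), spow x n * x = x := by
    filter_upwards [Ultrafilter.compl_mem_iff_notMem.2 hBU] with x hx using not_not.1 hx
  let q (x : T) : Idem T := ⟨spow x n, hn x⟩
  have hq : Tendsto (fun x => h (q x).1) U (𝓝 (spow y n)) := by
    have := ((continuous_spow n).tendsto y).comp hU
    exact this.congr fun x => (map_spow h x n).symm
  have hyL : spow y n * y = y := by
    refine tendsto_nhds_unique_of_eventuallyEq (hq.mul hU) hU ?_
    filter_upwards [hBU] with x hx
    rw [← map_mul]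
    exact congrArg h hx
  obtain ⟨e₀, -, he₀⟩ := exists_map_idem_eq h (D := univ) (y := spow y n)
    (fun _ _ _ _ => mem_univ _) (mem_closure_of_tendsto hq (.of_forall fun x =>
      mem_image_of_mem _ (mem_univ (q x))))
  obtain ⟨e, he, hmin⟩ := wellFounded_lt.has_min {e : Idem T | h e.1 = spow y n} ⟨e₀, he₀⟩
  have heq : ∀ᶠ x in (U : Filter T), e ≤ q x := by
    by_contra hcon
    have hcon := Ultrafilter.eventually_not.2 hcon
    have hlim : Tendsto (fun x => h (e ⊓ q x).1) U (𝓝 (spow y n)) := by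
      have h1 : Tendsto (fun x => h e.1 * h (q x).1) U (𝓝 (h e.1 * spow y n)) := hq.const_mul _
      have h2 : h e.1 * spow y n = spow y n := by
        rw [← he, ← map_mul, e.2]
      rw [h2] at h1
      exact h1.congr fun x => (map_mul h e.1 (q x).1).symm
    obtain ⟨f, hf, hfy⟩ := exists_map_idem_eq h (D := {f | f < e}) (y := spow y n)
      (fun f hf _ _ => lt_of_le_of_lt inf_le_left (show f < e from hf))
      (mem_closure_of_tendsto hlim (by
        filter_upwards [hcon] with x hx
        exact ⟨e ⊓ q x, inf_le_left.lt_of_ne fun h => hx (inf_eq_left.1 h), rfl⟩))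
    exact hmin f hfy hf
  have hmem : {x : T | e.1 * x = x ∧ spow x n = e.1} ∈ U.map (e.1 * ·) := by
    change ∀ᶠ x in U, e.1 * (e.1 * x) = e.1 * x ∧ spow (e.1 * x) n = e.1
    filter_upwards [heq] with x hx
    refine ⟨by rw [← mul_assoc, e.2], ?_⟩
    rw [mul_spow_of_central (mul_comm e.1), spow_of_idem e.2]
    exact hx
  refine mem_range_of_finite_mem (U.map (e.1 * ·)) (h := h) ?_ (hH e) hmem
  change Tendsto h (map (e.1 * ·) U) (𝓝 y)
  rw [tendsto_map'_iff]
  have h1 : Tendsto (fun x => h e.1 * h x) U (𝓝 (h e.1 * y)) := hU.const_mul _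
  rw [show h e.1 * y = y from (congrArg (· * y) he).trans hyL] at h1
  exact h1.congr fun x => (map_mul h e.1 x).symm

theorem statement4 (X : Type u) [Semigroup X] (hX : AbsolutelyTzSClosed X) :
    (∃ n : ℕ, ∀ z ∈ (idealCenter X : Set X), spow z n ∈ idemSet X) ∧
      AbsolutelyT2SClosed ↥(idealCenter X) := by
  obtain ⟨n, hn⟩ := hX.exists_forall_spow_idem
  refine ⟨⟨n, hn⟩, ?_⟩
  have hLT := hX.wellFoundedLT
  have hGT := hX.wellFoundedGT
  have hcoe (x : idealCenter X) (k : ℕ) :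
      ((spow x k : idealCenter X) : X) = spow (x : X) k :=
    map_spow (MulMemClass.subtype (idealCenter X)) x k
  have hn' (x : idealCenter X) : spow x n * spow x n = spow x n :=
    Subtype.ext (by simpa only [MulMemClass.coe_mul, hcoe] using hn x x.2)
  refine absolutelyT2SClosed_of_finite (idealCenter X) n hn' ?_ fun e => ?_
  · refine Finite.of_finite_image (f := Subtype.val) (hX.finite_not_isPeriodicUnit.subset ?_)
      Subtype.val_injective.injOn
    rintro _ ⟨x, hx, rfl⟩
    refine ⟨x.2, ?_⟩
    rintro ⟨k, hk, hkx⟩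
    refine hx (Subtype.ext ?_)
    rw [MulMemClass.coe_mul, hcoe, ← spow_eq_spow_of_idem hk (hn x x.2), hkx]
  · refine Finite.of_finite_image (f := Subtype.val) ((hX.finite_setOf_invMod e).subset ?_)
      Subtype.val_injective.injOn
    rintro _ ⟨x, ⟨hx, hxe⟩, rfl⟩
    refine ⟨congrArg Subtype.val hx, ((spow x (n + n) : idealCenter X) : X),
      (spow x (n + n) : idealCenter X).2, ?_⟩
    rw [← hxe, ← MulMemClass.coe_mul]
    refine congrArg Subtype.val ((spow_mul_spow x 0 _).trans ?_)
    rw [zero_add, ← spow_mul_spow]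
    exact hn' x
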